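/- arXiv:2204.14128 — 4 statements merged into one kernel-verified Lean document; each statement's English description precedes it below -/
import Mathlib

section
/- Let I=[a,b]⊂ℝ be a closed nondegenerate interval, let φ∈Φ_c be independent of x, and let K := lim_{t→∞} φ(t)/t (the limit exists in (0,∞] since φ(t)/t is increasing). Suppose K<∞, f:I→ℝ is left-continuous, and V^φ_I(f)<∞. Then f∈BV(I) and V^φ_I(f) = ∫_I φ(|f'(x)|) dx + K·|D^s f|(I). -/
open MeasureTheory Filter Set
open scoped ENNReal

noncomputable section

/-- A partition of the interval `[a, b]` into finitely many nondegenerate closed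
subintervals with pairwise disjoint interiors, encoded by its endpoints
`a = x 0 < x 1 < ⋯ < x n = b`. -/
structure IntervalPartition (a b : ℝ) where
  n : ℕ
  npos : 0 < n
  x : ℕ → ℝ
  left : x 0 = a
  right : x n = b
  strict : ∀ i < n, x i < x (i + 1)

/-- The mesh `|(I_k)|` of a partition: the maximal length of its subintervals. -/
def IntervalPartition.mesh {a b : ℝ} (P : IntervalPartition a b) : ℝ :=
  (Finset.range P.n).sup' (Finset.nonempty_range_iff.mpr P.npos.ne')
    fun k => P.x (k + 1) - P.x k

/-- `φ⁺_A(t) = sup_{x ∈ A} φ(x, t)`. -/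
def phiSup {α : Type*} (φ : α → ℝ → ℝ≥0∞) (A : Set α) (t : ℝ) : ℝ≥0∞ :=
  ⨆ x ∈ A, φ x t

/-- `φ⁻_A(t) = inf_{x ∈ A} φ(x, t)`. -/
def phiInf {α : Type*} (φ : α → ℝ → ℝ≥0∞) (A : Set α) (t : ℝ) : ℝ≥0∞ :=
  ⨅ x ∈ A, φ x t

/-- `Σ_k φ⁺_{I_k}(|Δ_k f| / |I_k|) · |I_k|` associated to a partition of `[a,b]`. -/
def vSum (φ : ℝ → ℝ → ℝ≥0∞) {a b : ℝ} (f : ℝ → ℝ) (P : IntervalPartition a b) : ℝ≥0∞ :=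
  ∑ k ∈ Finset.range P.n,
    phiSup φ (Icc (P.x k) (P.x (k + 1)))
        (|f (P.x (k + 1)) - f (P.x k)| / (P.x (k + 1) - P.x k)) *
      ENNReal.ofReal (P.x (k + 1) - P.x k)

/-- The same sum with `φ⁻` in place of `φ⁺`. -/
def vSumInf (φ : ℝ → ℝ → ℝ≥0∞) {a b : ℝ} (f : ℝ → ℝ) (P : IntervalPartition a b) : ℝ≥0∞ :=
  ∑ k ∈ Finset.range P.n,
    phiInf φ (Icc (P.x k) (P.x (k + 1)))
        (|f (P.x (k + 1)) - f (P.x k)| / (P.x (k + 1) - P.x k)) *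
      ENNReal.ofReal (P.x (k + 1) - P.x k)

/-- The Riesz φ-variation `V^φ_I(f)`: supremum over all partitions. -/
def rieszVar (φ : ℝ → ℝ → ℝ≥0∞) (a b : ℝ) (f : ℝ → ℝ) : ℝ≥0∞ :=
  ⨆ P : IntervalPartition a b, vSum φ f P

/-- The upper Riesz φ-variation `V̄^φ_I(f) = limsup_{|(I_k)|→0} Σ φ⁺_{I_k}(|Δ_k f|/|I_k|)|I_k|`. -/
def rieszVarUpper (φ : ℝ → ℝ → ℝ≥0∞) (a b : ℝ) (f : ℝ → ℝ) : ℝ≥0∞ :=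
  ⨅ (δ : ℝ) (_ : 0 < δ), ⨆ (P : IntervalPartition a b) (_ : P.mesh < δ), vSum φ f P

/-- The lower Riesz φ-variation `V̲^φ_I(f) = limsup_{|(I_k)|→0} Σ φ⁻_{I_k}(|Δ_k f|/|I_k|)|I_k|`. -/
def rieszVarLower (φ : ℝ → ℝ → ℝ≥0∞) (a b : ℝ) (f : ℝ → ℝ) : ℝ≥0∞ :=
  ⨅ (δ : ℝ) (_ : 0 < δ), ⨆ (P : IntervalPartition a b) (_ : P.mesh < δ), vSumInf φ f P

/-- Riesz φ-variation for `φ` independent of `x`. -/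
def vSumC (φ : ℝ → ℝ≥0∞) {a b : ℝ} (f : ℝ → ℝ) (P : IntervalPartition a b) : ℝ≥0∞ :=
  ∑ k ∈ Finset.range P.n,
    φ (|f (P.x (k + 1)) - f (P.x k)| / (P.x (k + 1) - P.x k)) *
      ENNReal.ofReal (P.x (k + 1) - P.x k)

def rieszVarC (φ : ℝ → ℝ≥0∞) (a b : ℝ) (f : ℝ → ℝ) : ℝ≥0∞ :=
  ⨆ P : IntervalPartition a b, vSumC φ f P

def rieszVarUpperC (φ : ℝ → ℝ≥0∞) (a b : ℝ) (f : ℝ → ℝ) : ℝ≥0∞ :=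
  ⨅ (δ : ℝ) (_ : 0 < δ), ⨆ (P : IntervalPartition a b) (_ : P.mesh < δ), vSumC φ f P

/-- A weak Φ-function on `I` (`φ ∈ Φ_w(I)`). -/
structure IsPhiW {α : Type*} [MeasurableSpace α] (φ : α → ℝ → ℝ≥0∞) (I : Set α) : Prop where
  meas : ∀ f : α → ℝ, Measurable f → Measurable fun x => φ x |f x|
  mono : ∀ x ∈ I, MonotoneOn (φ x) (Ici 0)
  map_zero : ∀ x ∈ I, φ x 0 = 0
  tendsto_zero : ∀ x ∈ I, Tendsto (φ x) (nhdsWithin 0 (Ioi 0)) (nhds 0)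
  tendsto_top : ∀ x ∈ I, Tendsto (φ x) atTop (nhds ⊤)
  aInc1 : ∃ L : ℝ, 1 ≤ L ∧ ∀ x ∈ I, ∀ s t : ℝ, 0 < s → s ≤ t →
    φ x s / ENNReal.ofReal s ≤ ENNReal.ofReal L * (φ x t / ENNReal.ofReal t)

/-- A convex Φ-function on `I` (`φ ∈ Φ_c(I)`): weak, convex and left-continuous in `t`. -/
structure IsPhiCx {α : Type*} [MeasurableSpace α] (φ : α → ℝ → ℝ≥0∞) (I : Set α) : Prop where
  toIsPhiW : IsPhiW φ I
  convex : ∀ x ∈ I, ∀ s t θ : ℝ, 0 ≤ s → 0 ≤ t → 0 ≤ θ → θ ≤ 1 →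
    φ x (θ * s + (1 - θ) * t) ≤ ENNReal.ofReal θ * φ x s + ENNReal.ofReal (1 - θ) * φ x t
  leftCont : ∀ x ∈ I, ∀ t : ℝ, 0 < t → Tendsto (φ x) (nhdsWithin t (Iio t)) (nhds (φ x t))

/-- An `x`-independent convex Φ-function (`φ ∈ Φ_c`). -/
structure IsPhiC (φ : ℝ → ℝ≥0∞) : Prop where
  mono : MonotoneOn φ (Ici 0)
  map_zero : φ 0 = 0
  tendsto_zero : Tendsto φ (nhdsWithin 0 (Ioi 0)) (nhds 0)
  tendsto_top : Tendsto φ atTop (nhds ⊤)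
  convex : ∀ s t θ : ℝ, 0 ≤ s → 0 ≤ t → 0 ≤ θ → θ ≤ 1 →
    φ (θ * s + (1 - θ) * t) ≤ ENNReal.ofReal θ * φ s + ENNReal.ofReal (1 - θ) * φ t
  leftCont : ∀ t : ℝ, 0 < t → Tendsto φ (nhdsWithin t (Iio t)) (nhds (φ t))

/-- `(aInc)_1` with a given constant `L`. -/
def AInc1Const (φ : ℝ → ℝ → ℝ≥0∞) (I : Set ℝ) (L : ℝ) : Prop :=
  1 ≤ L ∧ ∀ x ∈ I, ∀ s t : ℝ, 0 < s → s ≤ t →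
    φ x s / ENNReal.ofReal s ≤ ENNReal.ofReal L * (φ x t / ENNReal.ofReal t)

/-- `(aInc)_p`: `t ↦ φ(x,t)/t^p` is almost increasing, uniformly in `x ∈ I`. -/
def AIncP (φ : ℝ → ℝ → ℝ≥0∞) (I : Set ℝ) (p : ℝ) : Prop :=
  ∃ Lp : ℝ, 1 ≤ Lp ∧ ∀ x ∈ I, ∀ s t : ℝ, 0 < s → s ≤ t →
    φ x s / ENNReal.ofReal (s ^ p) ≤ ENNReal.ofReal Lp * (φ x t / ENNReal.ofReal (t ^ p))

/-- `(aDec)_q`: `t ↦ φ(x,t)/t^q` is almost decreasing, uniformly in `x ∈ I`. -/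
def ADecQ (φ : ℝ → ℝ → ℝ≥0∞) (I : Set ℝ) (q : ℝ) : Prop :=
  ∃ Lq : ℝ, 1 ≤ Lq ∧ ∀ x ∈ I, ∀ s t : ℝ, 0 < s → s ≤ t →
    φ x t / ENNReal.ofReal (t ^ q) ≤ ENNReal.ofReal Lq * (φ x s / ENNReal.ofReal (s ^ q))

/-- `(A0)`. -/
def A0 (φ : ℝ → ℝ → ℝ≥0∞) (I : Set ℝ) : Prop :=
  ∃ β : ℝ, 0 < β ∧ β ≤ 1 ∧ ∀ x ∈ I, φ x β ≤ 1 ∧ 1 ≤ φ x (1 / β)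

/-- `(A1)`; in dimension one a ball of radius `r` has measure `2r`. -/
def A1 (φ : ℝ → ℝ → ℝ≥0∞) (I : Set ℝ) : Prop :=
  ∀ K : ℝ, 0 < K → ∃ β : ℝ, 0 < β ∧ β ≤ 1 ∧
    ∀ z r : ℝ, 0 < r → ∀ x ∈ Metric.ball z r ∩ I, ∀ y ∈ Metric.ball z r ∩ I,
      ∀ t : ℝ, 0 ≤ t → φ y t ≤ ENNReal.ofReal (K / (2 * r)) →
        φ x (β * t) ≤ φ y t + 1

/-- A modulus of continuity: nonnegative with `ω(r) → 0` as `r → 0⁺`. -/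
def IsModulus (ω : ℝ → ℝ) : Prop :=
  (∀ r, 0 ≤ ω r) ∧ Tendsto ω (nhdsWithin 0 (Ioi 0)) (nhds 0)

/-- `(VA1)`; in dimension one a ball of radius `r` has measure `2r`. -/
def VA1 (φ : ℝ → ℝ → ℝ≥0∞) (I : Set ℝ) : Prop :=
  ∀ K : ℝ, 0 < K → ∃ ω : ℝ → ℝ, IsModulus ω ∧
    ∀ z r : ℝ, 0 < r → ∀ x ∈ Metric.ball z r ∩ I, ∀ y ∈ Metric.ball z r ∩ I,
      ∀ t : ℝ, 0 ≤ t → φ y t ≤ ENNReal.ofReal (K / (2 * r)) →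
        φ x (t / (1 + ω r)) ≤ φ y t + ENNReal.ofReal (ω r)

/-- `φ'_∞(x) = lim_{t→∞} φ(x,t)/t`, realized as a supremum since the ratio is nondecreasing
for convex `φ` with `φ(x,0) = 0`. -/
def phiInfty {α : Type*} (φ : α → ℝ → ℝ≥0∞) (x : α) : ℝ≥0∞ :=
  ⨆ (t : ℝ) (_ : 0 < t), φ x t / ENNReal.ofReal t

/-- Membership in `RBV^φ([a,b])`: `V^φ(λ f) → 0` as `λ → 0⁺`. -/
def MemRBV (φ : ℝ → ℝ → ℝ≥0∞) (a b : ℝ) (f : ℝ → ℝ) : Prop :=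
  Tendsto (fun lam : ℝ => rieszVar φ a b fun x => lam * f x) (nhdsWithin 0 (Ioi 0)) (nhds 0)

/-- The Luxemburg quasi-seminorm `‖f‖_{RBV^φ([a,b])}`. -/
def rbvNorm (φ : ℝ → ℝ → ℝ≥0∞) (a b : ℝ) (f : ℝ → ℝ) : ℝ :=
  sInf {lam : ℝ | 0 < lam ∧ rieszVar φ a b (fun x => f x / lam) ≤ 1}

/-- The Luxemburg quasi-seminorm associated to the upper Riesz variation. -/
def rbvNormUpper (φ : ℝ → ℝ → ℝ≥0∞) (a b : ℝ) (f : ℝ → ℝ) : ℝ :=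
  sInf {lam : ℝ | 0 < lam ∧ rieszVarUpper φ a b (fun x => f x / lam) ≤ 1}

/-- Membership in the generalized Orlicz space `L^φ([a,b])`. -/
def MemLphi (φ : ℝ → ℝ → ℝ≥0∞) (a b : ℝ) (g : ℝ → ℝ) : Prop :=
  Measurable g ∧
    Tendsto (fun lam : ℝ => ∫⁻ x in Icc a b, φ x (lam * |g x|))
      (nhdsWithin 0 (Ioi 0)) (nhds 0)

/-- The Luxemburg quasi-norm on `L^φ([a,b])`. -/
def lphiNorm (φ : ℝ → ℝ → ℝ≥0∞) (a b : ℝ) (g : ℝ → ℝ) : ℝ :=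
  sInf {lam : ℝ | 0 < lam ∧ (∫⁻ x in Icc a b, φ x (|g x| / lam)) ≤ 1}

/-- Absolute continuity of `f` on `[a, b]`. -/
def AbsContOn (f : ℝ → ℝ) (a b : ℝ) : Prop :=
  ∀ ε : ℝ, 0 < ε → ∃ δ : ℝ, 0 < δ ∧ ∀ (m : ℕ) (s t : ℕ → ℝ),
    (∀ i < m, a ≤ s i ∧ s i ≤ t i ∧ t i ≤ b) →
    (∀ i j, i < j → j < m → t i ≤ s j ∨ t j ≤ s i) →
    (∑ i ∈ Finset.range m, (t i - s i)) < δ →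
    (∑ i ∈ Finset.range m, |f (t i) - f (s i)|) < ε

/-- Left-continuity of `f` at every point of `(a, b]`. -/
def LeftContOn (f : ℝ → ℝ) (a b : ℝ) : Prop :=
  ∀ x ∈ Ioc a b, Tendsto f (nhdsWithin x (Iio x)) (nhds (f x))

/-- `μ` is the distributional derivative measure of the left-continuous function `f` of
bounded variation on `[a,b]`: `f(x) = f(a) + Df([a, x))`. -/
def IsDerivMeasure (f : ℝ → ℝ) (a b : ℝ) (μ : SignedMeasure ℝ) : Prop :=
  ∀ x ∈ Icc a b, f x = f a + μ (Ico a x)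

end
theorem rv_phi_affine (φ : ℝ → ℝ≥0∞) (hφ : IsPhiC φ)
    (K : ℝ≥0∞) (hK : Tendsto (fun t : ℝ => φ t / ENNReal.ofReal t) atTop (nhds K))
    (hKfin : K ≠ ⊤) :
    ∃ κ δ : ℕ → ℝ, (∀ n, 0 ≤ κ n) ∧ (∀ n, 0 ≤ δ n) ∧
      (∀ n t, 0 ≤ t → ENNReal.ofReal (κ n * t) ≤ φ t + ENNReal.ofReal (δ n)) ∧
      (∀ t, 0 ≤ t → ∀ w : ℝ≥0∞,
        (∀ n, ENNReal.ofReal (κ n * t) ≤ w + ENNReal.ofReal (δ n)) → φ t ≤ w) ∧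
      (∀ n, ENNReal.ofReal (κ n) ≤ K) ∧
      (∀ C : ℝ≥0∞, (∀ n, ENNReal.ofReal (κ n) ≤ C) → K ≤ C) ∧ ∃ n, 0 < κ n := by
  have hfin : ∀ t, 0 ≤ t → φ t ≠ ⊤ := by
    intro t ht
    have h1 : ∀ᶠ s in atTop, φ s / ENNReal.ofReal s < ⊤ :=
      hK.eventually (gt_mem_nhds hKfin.lt_top)
    obtain ⟨s, hs, hs2⟩ := (h1.and (eventually_ge_atTop (max t 1))).exists
    have hts : t ≤ s := (le_max_left _ _).trans hs2
    have : φ s ≠ ⊤ := by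
      intro h
      rw [h, ENNReal.top_div_of_ne_top ENNReal.ofReal_ne_top] at hs
      exact lt_irrefl _ hs
    exact ne_top_of_le_ne_top this (hφ.mono ht (ht.trans hts : (0:ℝ) ≤ s) hts)
  set ψ : ℝ → ℝ := fun t => (φ (max t 0)).toReal with hψ
  have hψmono : Monotone ψ := fun s t hst =>
    ENNReal.toReal_mono (hfin _ (le_max_right _ _))
      (hφ.mono (le_max_right s 0 : (0:ℝ) ≤ _) (le_max_right t 0 : (0:ℝ) ≤ _)
        (max_le_max_right _ hst))
  have hψφ : ∀ t, 0 ≤ t → φ t = ENNReal.ofReal (ψ t) := fun t ht => by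
    simp [hψ, max_eq_left ht, ENNReal.ofReal_toReal (hfin t ht)]
  have hψcx : ConvexOn ℝ univ ψ := by
    refine ⟨convex_univ, fun s _ t _ α β hα hβ hαβ => ?_⟩
    have hβ' : β = 1 - α := by linarith
    have h0 : max (α * s + β * t) 0 ≤ α * max s 0 + (1 - α) * max t 0 := by
      rw [← hβ']
      refine max_le (add_le_add ?_ ?_) (by positivity)
      · exact mul_le_mul_of_nonneg_left (le_max_left _ _) hα
      · exact mul_le_mul_of_nonneg_left (le_max_left _ _) hβ
    have h1 := hφ.convex (max s 0) (max t 0) α (le_max_right _ _) (le_max_right _ _) hα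
      (by linarith)
    have h2 : φ (max (α * s + β * t) 0) ≤ _ :=
      (hφ.mono (le_max_right _ 0 : (0:ℝ) ≤ _)
        ((le_max_right _ _).trans h0 : (0:ℝ) ≤ _) h0).trans h1
    rw [← hβ'] at h2
    have hs := hfin _ (le_max_right s 0)
    have ht := hfin _ (le_max_right t 0)
    have h3 := ENNReal.toReal_mono (by
      exact ENNReal.add_ne_top.2 ⟨ENNReal.mul_ne_top ENNReal.ofReal_ne_top hs,
        ENNReal.mul_ne_top ENNReal.ofReal_ne_top ht⟩) h2
    rw [ENNReal.toReal_add (ENNReal.mul_ne_top ENNReal.ofReal_ne_top hs)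
      (ENNReal.mul_ne_top ENNReal.ofReal_ne_top ht), ENNReal.toReal_mul, ENNReal.toReal_mul,
      ENNReal.toReal_ofReal hα, ENNReal.toReal_ofReal hβ] at h3
    simpa [hψ] using h3
  have hψc : Continuous ψ := by
    rw [← continuousOn_univ]
    exact hψcx.continuousOn isOpen_univ
  obtain ⟨l, c, hle, hsup⟩ := hψcx.real_univ_sSup_of_nat_affine_eq hψc.lowerSemicontinuous
  have hle' : ∀ n t, l n 1 * t + c n ≤ ψ t := fun n t => by
    have := hle n t
    simp only [Pi.add_apply, Function.const_apply] at this
    have e : l n t = l n 1 * t := by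
      conv_lhs => rw [show t = t • (1:ℝ) by simp, map_smul, smul_eq_mul, mul_comm]
    rwa [e] at this
  have hψ0 : ∀ t ≤ 0, ψ t = 0 := fun t ht => by simp [hψ, max_eq_right ht, hφ.map_zero]
  have hκ : ∀ n, 0 ≤ l n 1 := by
    intro n
    by_contra hneg
    push Not at hneg
    have := hle' n (min 0 ((1 - c n) / l n 1))
    rw [hψ0 _ (min_le_left _ _)] at this
    have h2 : l n 1 * ((1 - c n) / l n 1) ≤ l n 1 * (min 0 ((1 - c n) / l n 1)) :=
      mul_le_mul_of_nonpos_left (min_le_right _ _) hneg.le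
    rw [mul_div_cancel₀ _ hneg.ne] at h2
    linarith
  have hδ : ∀ n, 0 ≤ - c n := fun n => by
    have := hle' n 0
    rw [hψ0 0 le_rfl] at this
    linarith
  have hsup' : ∀ t r : ℝ, (∀ n, l n 1 * t + c n ≤ r) → ψ t ≤ r := by
    intro t r h
    rw [← hsup, iSup_apply]
    refine ciSup_le fun n => ?_
    have := h n
    rw [mul_comm, ← smul_eq_mul, ← map_smul] at this
    simpa using this
  have P3 : ∀ n t, 0 ≤ t → ENNReal.ofReal (l n 1 * t) ≤ φ t + ENNReal.ofReal (- c n) := by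
    intro n t ht
    rw [hψφ t ht, ← ENNReal.ofReal_add (ENNReal.toReal_nonneg) (hδ n)]
    exact ENNReal.ofReal_le_ofReal (by linarith [hle' n t])
  have P4 : ∀ t, 0 ≤ t → ∀ w : ℝ≥0∞,
        (∀ n, ENNReal.ofReal (l n 1 * t) ≤ w + ENNReal.ofReal (- c n)) → φ t ≤ w := by
    intro t ht w hw
    by_cases hwt : w = ⊤
    · simp [hwt]
    rw [hψφ t ht]
    refine ENNReal.ofReal_le_of_le_toReal (hsup' t _ fun n => ?_)
    have := hw n
    rw [← ENNReal.ofReal_toReal hwt, ← ENNReal.ofReal_add ENNReal.toReal_nonneg (hδ n),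
      ENNReal.ofReal_le_ofReal_iff (add_nonneg ENNReal.toReal_nonneg (hδ n))] at this
    linarith
  have P6 : ∀ C : ℝ≥0∞, (∀ n, ENNReal.ofReal (l n 1) ≤ C) → ∀ t, 0 ≤ t →
      φ t ≤ C * ENNReal.ofReal t := by
    intro C hC t ht
    refine P4 t ht _ fun n => ?_
    rw [ENNReal.ofReal_mul (hκ n)]
    exact (mul_le_mul_left (hC n) _).trans le_self_add
  refine ⟨fun n => l n 1, fun n => - c n, hκ, hδ, P3, P4, ?_, ?_, ?_⟩
  · intro n
    have hlim : Tendsto (fun t : ℝ => φ t / ENNReal.ofReal t +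
        ENNReal.ofReal (- c n) / ENNReal.ofReal t) atTop (nhds (K + 0)) := by
      refine hK.add ?_
      have : Tendsto (fun t : ℝ => ENNReal.ofReal (- c n / t)) atTop (nhds (ENNReal.ofReal 0)) :=
        ENNReal.tendsto_ofReal (tendsto_const_nhds.div_atTop tendsto_id)
      rw [ENNReal.ofReal_zero] at this
      refine this.congr' ?_
      filter_upwards [eventually_gt_atTop 0] with t ht
      rw [ENNReal.ofReal_div_of_pos ht]
    rw [add_zero] at hlim
    refine ge_of_tendsto hlim ?_
    filter_upwards [eventually_gt_atTop 0] with t ht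
    rw [ENNReal.div_add_div_same, ENNReal.le_div_iff_mul_le (by simp [ht]) (by simp),
      ← ENNReal.ofReal_mul (hκ n)]
    exact P3 n t ht.le
  · intro C hC
    refine le_of_tendsto hK ?_
    filter_upwards [eventually_gt_atTop 0] with t ht
    exact ENNReal.div_le_of_le_mul (P6 C hC t ht.le)
  · by_contra! hno
    have h0 : ∀ t, 0 ≤ t → φ t = 0 := fun t ht => by
      have := P6 0 (fun n => by simp [hno n]) t ht
      simpa using this
    have h1 : ∀ᶠ s in atTop, (0:ℝ≥0∞) < φ s :=
      hφ.tendsto_top.eventually (lt_mem_nhds ENNReal.zero_lt_top)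
    obtain ⟨s, hs, hs0⟩ := (h1.and (eventually_ge_atTop 0)).exists
    rw [h0 s hs0] at hs
    exact lt_irrefl _ hs

theorem rv_signed_eq (μ : SignedMeasure ℝ) {A : Set ℝ} (hA : MeasurableSet A) :
    μ A = SignedMeasure.singularPart μ volume A
      + ∫ x in A, SignedMeasure.rnDeriv μ volume x := by
  conv_lhs => rw [← SignedMeasure.singularPart_add_withDensity_rnDeriv_eq volume (s := μ)]
  rw [add_apply, withDensityᵥ_apply (SignedMeasure.integrable_rnDeriv μ volume) hA]

theorem rv_tv_split (σ : SignedMeasure ℝ) : ∃ i : Set ℝ, MeasurableSet i ∧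
    ∀ A, MeasurableSet A → σ.totalVariation A =
      ENNReal.ofReal (|σ (A ∩ i)|) + ENNReal.ofReal (|σ (A ∩ iᶜ)|) := by
  obtain ⟨i, hi₁, hi₂, hi₃, hp, hn⟩ := σ.toJordanDecomposition_spec
  refine ⟨i, hi₁, fun A hA => ?_⟩
  have h1 : 0 ≤ σ (i ∩ A) := by
    have := σ.toMeasureOfZeroLE_real_apply hi₂ hi₁ hA
    rw [← this]; exact ENNReal.toReal_nonneg
  have h2 : 0 ≤ - σ (iᶜ ∩ A) := by
    have := σ.toMeasureOfLEZero_real_apply hi₃ hi₁.compl hA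
    rw [← this]; exact ENNReal.toReal_nonneg
  rw [SignedMeasure.totalVariation, Measure.add_apply]
  congr 1
  · rw [inter_comm, abs_of_nonneg h1, hp, ← σ.toMeasureOfZeroLE_real_apply hi₂ hi₁ hA,
      Measure.real, ENNReal.ofReal_toReal (measure_ne_top _ _)]
  · rw [inter_comm, abs_of_nonpos (by linarith), hn,
      ← σ.toMeasureOfLEZero_real_apply hi₃ hi₁.compl hA,
      Measure.real, ENNReal.ofReal_toReal (measure_ne_top _ _)]

theorem rv_abs_le_tv (σ : SignedMeasure ℝ) {A : Set ℝ} (hA : MeasurableSet A) :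
    ENNReal.ofReal |σ A| ≤ σ.totalVariation A := by
  obtain ⟨i, hi, h⟩ := rv_tv_split σ
  rw [h A hA, ← ENNReal.ofReal_add (abs_nonneg _) (abs_nonneg _)]
  refine ENNReal.ofReal_le_ofReal ?_
  have : σ A = σ (A ∩ i) + σ (A ∩ iᶜ) := by
    rw [← VectorMeasure.of_union _ (hA.inter hi) (hA.inter hi.compl), inter_union_compl]
    exact (disjoint_compl_right (a := i)).mono inter_subset_right inter_subset_right
  rw [this]
  exact abs_add_le _ _

theorem rv_abs_le (μ : SignedMeasure ℝ) {A : Set ℝ} (hA : MeasurableSet A) :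
    ENNReal.ofReal |μ A| ≤ (∫⁻ x in A, ENNReal.ofReal |SignedMeasure.rnDeriv μ volume x|)
      + (SignedMeasure.singularPart μ volume).totalVariation A := by
  rw [rv_signed_eq μ hA, add_comm (∫⁻ x in A, _)]
  refine (ENNReal.ofReal_le_ofReal (abs_add_le _ _)).trans ?_
  rw [ENNReal.ofReal_add (abs_nonneg _) (abs_nonneg _)]
  refine add_le_add (rv_abs_le_tv _ hA) ?_
  have := enorm_integral_le_lintegral_enorm (μ := volume.restrict A)
    (SignedMeasure.rnDeriv μ volume)
  simpa [Real.enorm_eq_ofReal_abs] using this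

theorem rv_lower (φ : ℝ → ℝ≥0∞) (K : ℝ≥0∞) (κ δ : ℕ → ℝ) (hκ : ∀ n, 0 ≤ κ n)
    (P4 : ∀ t, 0 ≤ t → ∀ w : ℝ≥0∞,
        (∀ n, ENNReal.ofReal (κ n * t) ≤ w + ENNReal.ofReal (δ n)) → φ t ≤ w)
    (P6 : ∀ C : ℝ≥0∞, (∀ n, ENNReal.ofReal (κ n) ≤ C) → K ≤ C)
    (μ : SignedMeasure ℝ) (ν : Measure ℝ) [IsFiniteMeasure ν]
    (hC : ∀ n A, MeasurableSet A →
      ENNReal.ofReal (κ n * |μ A|) ≤ ν A + ENNReal.ofReal (δ n) * volume A) :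
    (∫⁻ x, φ |SignedMeasure.rnDeriv μ volume x|)
      + K * (SignedMeasure.singularPart μ volume).totalVariation univ ≤ ν univ := by
  set g := SignedMeasure.rnDeriv μ volume with hg
  have hgm : Measurable g := SignedMeasure.measurable_rnDeriv μ volume
  have hgi : Integrable g := SignedMeasure.integrable_rnDeriv μ volume
  set σ := SignedMeasure.singularPart μ volume with hσ
  have hsing : σ.totalVariation ⟂ₘ volume := by
    have := SignedMeasure.mutuallySingular_singularPart μ volume
    rwa [SignedMeasure.mutuallySingular_ennreal_iff,
      VectorMeasure.ennrealToMeasure_toENNRealVectorMeasure] at this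
  obtain ⟨s, hs, hs1, hs2⟩ := hsing
  obtain ⟨s', hs', hs1', hs2'⟩ := Measure.mutuallySingular_singularPart ν volume
  set w := ν.rnDeriv volume with hw
  have hwm : Measurable w := Measure.measurable_rnDeriv _ _
  have hνw : ∀ A, MeasurableSet A → A ⊆ s' → ν A = ∫⁻ x in A, w x := by
    intro A hA hAs
    conv_lhs => rw [Measure.haveLebesgueDecomposition_add ν volume]
    rw [Measure.add_apply, measure_mono_null hAs hs1', zero_add, withDensity_apply _ hA]
  have hμs : ∀ A, MeasurableSet A → A ⊆ s → μ A = ∫ x in A, g x := by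
    intro A hA hAs
    rw [rv_signed_eq μ hA, SignedMeasure.null_of_totalVariation_zero _
      (measure_mono_null hAs hs1), zero_add]
  have hμsc : ∀ A, MeasurableSet A → A ⊆ sᶜ → μ A = σ A := by
    intro A hA hAs
    rw [rv_signed_eq μ hA, setIntegral_measure_zero _ (measure_mono_null hAs hs2), add_zero]
  -- singular part
  have S1 : K * σ.totalVariation univ ≤ ν sᶜ := by
    obtain ⟨i, hi, hsp⟩ := rv_tv_split σ
    have e1 : σ.totalVariation univ = σ.totalVariation sᶜ := by
      rw [← measure_add_measure_compl hs, hs1, zero_add]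
    rw [e1]
    have key : ∀ n, ENNReal.ofReal (κ n) * σ.totalVariation sᶜ ≤ ν sᶜ := by
      intro n
      have aux : ∀ B, MeasurableSet B → B ⊆ sᶜ →
          ENNReal.ofReal (κ n) * ENNReal.ofReal |σ B| ≤ ν B := by
        intro B hB hBs
        have := hC n B hB
        rwa [hμsc B hB hBs, measure_mono_null hBs hs2, mul_zero, add_zero,
          ENNReal.ofReal_mul (hκ n)] at this
      rw [hsp _ hs.compl, mul_add]
      refine (add_le_add (aux _ (hs.compl.inter hi) inter_subset_left)
        (aux _ (hs.compl.inter hi.compl) inter_subset_left)).trans ?_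
      rw [← measure_inter_add_sdiff sᶜ hi, Set.sdiff_eq]
    by_cases h0 : σ.totalVariation sᶜ = 0
    · simp [h0]
    · have : K ≤ ν sᶜ / σ.totalVariation sᶜ := P6 _ fun n => by
        rw [ENNReal.le_div_iff_mul_le (Or.inl h0) (Or.inl (measure_ne_top _ _))]
        exact key n
      rwa [ENNReal.le_div_iff_mul_le (Or.inl h0) (Or.inl (measure_ne_top _ _))] at this
  -- absolutely continuous part
  have A1 : ∀ n, (fun x => ENNReal.ofReal (κ n * |g x|)) ≤ᵐ[volume]
      fun x => w x + ENNReal.ofReal (δ n) := by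
    intro n
    refine ae_le_of_forall_setLIntegral_le_of_sigmaFinite (by fun_prop) fun A hA _ => ?_
    have aux : ∀ B, MeasurableSet B → B ⊆ s → B ⊆ s' →
        ((∀ x ∈ B, 0 ≤ g x) ∨ (∀ x ∈ B, g x ≤ 0)) →
        ∫⁻ x in B, ENNReal.ofReal (κ n * |g x|) ≤ ∫⁻ x in B, (w x + ENNReal.ofReal (δ n)) := by
      intro B hB hBs hBs' hsgn
      rw [lintegral_add_left hwm, setLIntegral_const, ← hνw B hB hBs']
      refine le_trans (le_of_eq ?_) (hC n B hB)
      rw [hμs B hB hBs]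
      have : |∫ x in B, g x| = ∫ x in B, |g x| := by
        rcases hsgn with h | h
        · rw [abs_of_nonneg (setIntegral_nonneg hB h)]
          exact setIntegral_congr_fun hB fun x hx => (abs_of_nonneg (h x hx)).symm
        · rw [abs_of_nonpos (setIntegral_nonpos hB h), ← integral_neg]
          exact setIntegral_congr_fun hB fun x hx => (abs_of_nonpos (h x hx)).symm
      rw [this, ← integral_const_mul, ofReal_integral_eq_lintegral_ofReal]
      · exact (hgi.abs.const_mul _).integrableOn
      · exact Eventually.of_forall fun x => mul_nonneg (hκ n) (abs_nonneg _)
    set D := {x | 0 ≤ g x} with hD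
    have hDm : MeasurableSet D := measurableSet_le measurable_const hgm
    set B := A ∩ (s ∩ s') with hB
    have hBm : MeasurableSet B := hA.inter (hs.inter hs')
    have hAB : A =ᵐ[volume] B := by
      have : ∀ᵐ x ∂(volume : Measure ℝ), x ∈ s ∩ s' := by
        rw [ae_iff]
        refine measure_mono_null (t := sᶜ ∪ s'ᶜ) ?_ (measure_union_null hs2 hs2')
        intro x hx
        rw [← compl_inter]; exact hx
      filter_upwards [this] with x hx
      apply propext
      exact ⟨fun h => ⟨h, hx⟩, fun h => h.1⟩
    rw [setLIntegral_congr hAB, setLIntegral_congr hAB, ← lintegral_inter_add_sdiff _ B hDm,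
      ← lintegral_inter_add_sdiff (fun x => w x + _) B hDm]
    refine add_le_add (aux _ (hBm.inter hDm) (fun x hx => hx.1.2.1) (fun x hx => hx.1.2.2)
      (Or.inl fun x hx => hx.2)) (aux _ (hBm.diff hDm) (fun x hx => hx.1.2.1)
      (fun x hx => hx.1.2.2) (Or.inr fun x hx => ?_))
    exact (not_le.1 hx.2).le
  have A2 : ∫⁻ x, φ |g x| ≤ ν s := by
    calc ∫⁻ x, φ |g x| ≤ ∫⁻ x, w x := by
          refine lintegral_mono_ae ?_
          filter_upwards [ae_all_iff.2 A1] with x hx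
          exact P4 _ (abs_nonneg _) _ hx
      _ = ∫⁻ x in s, w x := by
          rw [← lintegral_add_compl _ hs, setLIntegral_measure_zero sᶜ _ hs2, add_zero]
      _ = (volume.withDensity w) s := (withDensity_apply _ hs).symm
      _ ≤ ν s := Measure.withDensity_rnDeriv_le _ _ _
  rw [← measure_add_measure_compl (μ := ν) hs]
  exact add_le_add A2 S1

noncomputable def rvM {f : ℝ → ℝ} (hf : Monotone f) : Measure ℝ := hf.stieltjesFunction.measure

instance {f : ℝ → ℝ} (hf : Monotone f) : IsLocallyFiniteMeasure (rvM hf) := by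
  unfold rvM; infer_instance

theorem rvM_Ico {f : ℝ → ℝ} (hf : Monotone f) (x y : ℝ) :
    rvM hf (Ico x y) = ENNReal.ofReal (Function.leftLim f y - Function.leftLim f x) := by
  have : ∀ z, Function.leftLim hf.stieltjesFunction z = Function.leftLim f z := fun z =>
    leftLim_rightLim (hf.tendsto_leftLim z)
  rw [rvM, StieltjesFunction.measure_Ico, this, this]

theorem rvM_add {f g h : ℝ → ℝ} (hf : Monotone f) (hg : Monotone g) (hh : Monotone h)
    (e : ∀ x, h x = f x + g x) : rvM hh = rvM hf + rvM hg := by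
  refine Measure.ext_of_Ico _ _ fun x y hxy => ?_
  have : ∀ z, Function.leftLim h z = Function.leftLim f z + Function.leftLim g z := by
    intro z
    refine tendsto_nhds_unique (hh.tendsto_leftLim z) ?_
    refine ((hf.tendsto_leftLim z).add (hg.tendsto_leftLim z)).congr fun x => (e x).symm
  rw [Measure.add_apply, rvM_Ico, rvM_Ico, rvM_Ico, this, this, ← ENNReal.ofReal_add]
  · congr 1; ring
  · exact sub_nonneg.2 (hf.leftLim hxy.le)
  · exact sub_nonneg.2 (hg.leftLim hxy.le)

theorem rvM_smul {f h : ℝ → ℝ} (c : ℝ) (hc : 0 ≤ c) (hf : Monotone f) (hh : Monotone h)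
    (e : ∀ x, h x = c * f x) : rvM hh = ENNReal.ofReal c • rvM hf := by
  refine Measure.ext_of_Ico _ _ fun x y hxy => ?_
  have : ∀ z, Function.leftLim h z = c * Function.leftLim f z := by
    intro z
    refine tendsto_nhds_unique (hh.tendsto_leftLim z) ?_
    refine ((hf.tendsto_leftLim z).const_mul c).congr fun x => (e x).symm
  rw [Measure.smul_apply, rvM_Ico, rvM_Ico, this, this, smul_eq_mul, ← ENNReal.ofReal_mul hc]
  congr 1; ring

theorem rvM_id : rvM (monotone_id (α := ℝ)) = volume := by
  refine Measure.ext_of_Ico _ _ fun x y hxy => ?_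
  have : ∀ z : ℝ, Function.leftLim (id : ℝ → ℝ) z = z := fun z =>
    tendsto_nhds_unique (monotone_id.tendsto_leftLim z)
      (tendsto_id.mono_left nhdsWithin_le_nhds)
  rw [rvM_Ico, this, this, Real.volume_Ico]

theorem rv_construct (a b : ℝ) (W F : ℝ → ℝ) (hW : Monotone W)
    (hF : ∀ x, Tendsto F (nhdsWithin x (Iio x)) (nhds (F x)))
    (κ δ : ℕ → ℝ) (hκ : ∀ n, 0 ≤ κ n) (hδ : ∀ n, 0 ≤ δ n)
    (hmon : ∀ n x y, x ≤ y → κ n * |F y - F x| ≤ W y - W x + δ n * (y - x))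
    (hpos : ∃ n, 0 < κ n) :
    ∃ μ : SignedMeasure ℝ,
      (∀ x y, a ≤ x → x ≤ y → y ≤ b → μ (Ico x y) = F y - F x) ∧
      ∀ n A, MeasurableSet A → ENNReal.ofReal (κ n * |μ A|) ≤
        (rvM hW).restrict (Ico a b) A + ENNReal.ofReal (δ n) * volume A := by
  obtain ⟨m, hm⟩ := hpos
  have hU : ∀ n, Monotone fun x => W x + δ n * x := fun n x y hxy =>
    add_le_add (hW hxy) (mul_le_mul_of_nonneg_left hxy (hδ n))
  set G : ℝ → ℝ := fun x => (W x + δ m * x) / κ m with hGdef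
  set L : ℝ → ℝ := fun x => G x - F x with hLdef
  have hG : Monotone G := fun x y hxy => div_le_div_of_nonneg_right (hU m hxy) hm.le
  have hL : Monotone L := by
    intro x y hxy
    have h1 := hmon m x y hxy
    have h2 := le_abs_self (F y - F x)
    have h3 : F y - F x ≤ G y - G x := by
      have : G y - G x = (W y - W x + δ m * (y - x)) / κ m := by
        simp only [hGdef]; ring
      rw [this, le_div_iff₀ hm]
      nlinarith
    simp only [hLdef]; linarith
  set I := Ico a b with hI
  have : IsFiniteMeasure ((rvM hG).restrict I) := ⟨by
    rw [Measure.restrict_apply_univ]; exact measure_Ico_lt_top⟩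
  have : IsFiniteMeasure ((rvM hL).restrict I) := ⟨by
    rw [Measure.restrict_apply_univ]; exact measure_Ico_lt_top⟩
  have hμ : ∀ A, MeasurableSet A → (((rvM hG).restrict I).toSignedMeasure -
      ((rvM hL).restrict I).toSignedMeasure) A =
        (rvM hG (A ∩ I)).toReal - (rvM hL (A ∩ I)).toReal := by
    intro A hA
    rw [Measure.toSignedMeasure_sub_apply hA, Measure.real, Measure.real,
      Measure.restrict_apply hA, Measure.restrict_apply hA]
  refine ⟨((rvM hG).restrict I).toSignedMeasure - ((rvM hL).restrict I).toSignedMeasure,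
    ?_, ?_⟩
  · intro x y hx hxy hy
    have : Ico x y ∩ I = Ico x y := inter_eq_left.2 (Ico_subset_Ico hx hy)
    have hlim : ∀ z, Function.leftLim L z = Function.leftLim G z - F z := fun z =>
      tendsto_nhds_unique (hL.tendsto_leftLim z) ((hG.tendsto_leftLim z).sub (hF z))
    rw [hμ _ measurableSet_Ico, this, rvM_Ico, rvM_Ico,
      ENNReal.toReal_ofReal (sub_nonneg.2 (hG.leftLim hxy)),
      ENNReal.toReal_ofReal (sub_nonneg.2 (hL.leftLim hxy)), hlim, hlim]
    ring
  · intro n A hA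
    set B := A ∩ I with hB
    rw [hμ A hA, Measure.restrict_apply hA]
    have hκG : Monotone fun x => κ n * G x := fun x y hxy =>
      mul_le_mul_of_nonneg_left (hG hxy) (hκ n)
    have hκL : Monotone fun x => κ n * L x := fun x y hxy =>
      mul_le_mul_of_nonneg_left (hL hxy) (hκ n)
    have hδx : Monotone fun x => δ n * id x := fun x y hxy =>
      mul_le_mul_of_nonneg_left hxy (hδ n)
    have hHp : Monotone fun x => W x + δ n * x - κ n * F x := by
      intro x y hxy
      have h1 := hmon n x y hxy
      have h2 := mul_le_mul_of_nonneg_left (le_abs_self (F y - F x)) (hκ n)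
      simp only
      nlinarith
    have hHm : Monotone fun x => W x + δ n * x + κ n * F x := by
      intro x y hxy
      have h1 := hmon n x y hxy
      have h2 := mul_le_mul_of_nonneg_left (neg_abs_le (F y - F x)) (hκ n)
      simp only
      nlinarith
    have eU : rvM (hU n) = rvM hW + ENNReal.ofReal (δ n) • volume := by
      rw [rvM_add hW hδx (hU n) (fun x => rfl), rvM_smul (δ n) (hδ n) monotone_id hδx
        (fun x => rfl), rvM_id]
    have hS1 : Monotone fun x => W x + δ n * x + κ n * L x := (hU n).add hκL
    have hS2 : Monotone fun x => W x + δ n * x + κ n * G x := (hU n).add hκG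
    have E1 : rvM hHp + ENNReal.ofReal (κ n) • rvM hG =
        rvM (hU n) + ENNReal.ofReal (κ n) • rvM hL := by
      rw [← rvM_smul (κ n) (hκ n) hG hκG (fun x => rfl),
        ← rvM_smul (κ n) (hκ n) hL hκL (fun x => rfl),
        ← rvM_add (hU n) hκL hS1 (fun x => rfl)]
      refine (rvM_add hHp hκG hS1 fun x => ?_).symm
      simp only [hLdef]; ring
    have E2 : rvM hHm + ENNReal.ofReal (κ n) • rvM hL =
        rvM (hU n) + ENNReal.ofReal (κ n) • rvM hG := by
      rw [← rvM_smul (κ n) (hκ n) hG hκG (fun x => rfl),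
        ← rvM_smul (κ n) (hκ n) hL hκL (fun x => rfl),
        ← rvM_add (hU n) hκG hS2 (fun x => rfl)]
      refine (rvM_add hHm hκL hS2 fun x => ?_).symm
      simp only [hLdef]; ring
    have fin : ∀ {f : ℝ → ℝ} (hf : Monotone f), rvM hf B ≠ ⊤ := fun hf =>
      ne_top_of_le_ne_top measure_Ico_lt_top.ne (measure_mono (inter_subset_right (s := A)))
    have ineq : ∀ p q : ℝ≥0∞, p ≠ ⊤ → q ≠ ⊤ →
        ENNReal.ofReal (κ n) * p ≤ rvM (hU n) B + ENNReal.ofReal (κ n) * q →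
        κ n * (p.toReal - q.toReal) ≤ (rvM (hU n) B).toReal := by
      intro p q hp hq h
      have h2 := ENNReal.toReal_mono (ENNReal.add_ne_top.2 ⟨fin (hU n),
        ENNReal.mul_ne_top ENNReal.ofReal_ne_top hq⟩) h
      rw [ENNReal.toReal_add (fin (hU n)) (ENNReal.mul_ne_top ENNReal.ofReal_ne_top hq),
        ENNReal.toReal_mul, ENNReal.toReal_mul, ENNReal.toReal_ofReal (hκ n)] at h2
      linarith
    have I1 : κ n * ((rvM hG B).toReal - (rvM hL B).toReal) ≤ (rvM (hU n) B).toReal := by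
      refine ineq _ _ (fin hG) (fin hL) ?_
      have := congrArg (fun m : Measure ℝ => m B) E1
      simp only [Measure.add_apply, Measure.smul_apply, smul_eq_mul] at this
      rw [← this]; exact le_add_self
    have I2 : κ n * ((rvM hL B).toReal - (rvM hG B).toReal) ≤ (rvM (hU n) B).toReal := by
      refine ineq _ _ (fin hL) (fin hG) ?_
      have := congrArg (fun m : Measure ℝ => m B) E2
      simp only [Measure.add_apply, Measure.smul_apply, smul_eq_mul] at this
      rw [← this]; exact le_add_self
    have I3 : ENNReal.ofReal (κ n * |(rvM hG B).toReal - (rvM hL B).toReal|) ≤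
        rvM (hU n) B := by
      refine ENNReal.ofReal_le_of_le_toReal ?_
      rcases abs_cases ((rvM hG B).toReal - (rvM hL B).toReal) with ⟨h, _⟩ | ⟨h, _⟩
      · rw [h]; exact I1
      · rw [h, neg_sub]; exact I2
    refine I3.trans ?_
    rw [eU, Measure.add_apply, Measure.smul_apply, smul_eq_mul]
    gcongr
    exact inter_subset_left

theorem rv_superadd (φ : ℝ → ℝ≥0∞) (f : ℝ → ℝ) {a x y : ℝ} (hax : a ≤ x) (hxy : x < y) :
    rieszVarC φ a x f + φ (|f y - f x| / (y - x)) * ENNReal.ofReal (y - x)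
      ≤ rieszVarC φ a y f := by
  rcases hax.eq_or_lt with rfl | hax
  · have : IsEmpty (IntervalPartition a a) := ⟨fun P => by
      have : ∀ k ≤ P.n, 0 < k → P.x 0 < P.x k := by
        intro k
        induction k with
        | zero => intro _ h; exact absurd h (lt_irrefl _)
        | succ k ih =>
          intro hk _
          rcases Nat.eq_zero_or_pos k with rfl | h
          · exact P.strict 0 hk
          · exact (ih (by omega) h).trans (P.strict k hk)
      have := this P.n le_rfl P.npos
      rw [P.left, P.right] at this
      exact lt_irrefl _ this⟩
    rw [rieszVarC, iSup_of_empty, bot_eq_zero, zero_add]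
    let P : IntervalPartition a y :=
      { n := 1, npos := one_pos, x := fun i => if i = 0 then a else y, left := by simp,
        right := by simp, strict := by
          intro i hi
          obtain rfl : i = 0 := by omega
          simpa using hxy }
    refine le_trans (le_of_eq ?_) (le_iSup (fun P => vSumC φ f P) P)
    simp [vSumC, P]
  · have : Nonempty (IntervalPartition a x) := ⟨
      { n := 1, npos := one_pos, x := fun i => if i = 0 then a else x, left := by simp,
        right := by simp, strict := by
          intro i hi
          obtain rfl : i = 0 := by omega
          simpa using hax }⟩
    rw [rieszVarC, ENNReal.iSup_add]
    refine iSup_le fun P => ?_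
    let Q : IntervalPartition a y :=
      { n := P.n + 1, npos := Nat.succ_pos _, x := fun i => if i ≤ P.n then P.x i else y,
        left := by simp [P.left], right := by simp, strict := by
          intro i hi
          rcases (Nat.lt_succ_iff.1 hi).eq_or_lt with rfl | h
          · simpa [P.right] using hxy
          · simpa [h.le, Nat.succ_le_of_lt h] using P.strict i h }
    refine le_trans (le_of_eq ?_) (le_iSup (fun P => vSumC φ f P) Q)
    simp only [vSumC, Q]
    rw [Finset.sum_range_succ]
    congr 1
    · refine Finset.sum_congr rfl fun k hk => ?_
      have hk := Finset.mem_range.1 hk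
      rw [if_pos hk.le, if_pos (Nat.succ_le_of_lt hk)]
    · simp [P.right]

theorem rv_sum_Ico (m : Measure ℝ) (x : ℕ → ℝ) (n : ℕ) (h : ∀ i < n, x i < x (i + 1)) :
    x 0 ≤ x n ∧ ∑ k ∈ Finset.range n, m (Ico (x k) (x (k + 1))) = m (Ico (x 0) (x n)) := by
  induction n with
  | zero => simp
  | succ n ih =>
    obtain ⟨h1, h2⟩ := ih fun i hi => h i (by omega)
    have h3 := h n (by omega)
    refine ⟨h1.trans h3.le, ?_⟩
    rw [Finset.sum_range_succ, h2, ← Ico_union_Ico_eq_Ico h1 h3.le,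
      measure_union _ measurableSet_Ico]
    exact Ico_disjoint_Ico_same

theorem rv_upper (a b : ℝ) (φ : ℝ → ℝ≥0∞) (K : ℝ≥0∞) (κ δ : ℕ → ℝ) (hκ : ∀ n, 0 ≤ κ n)
    (hδ : ∀ n, 0 ≤ δ n)
    (P3 : ∀ n t, 0 ≤ t → ENNReal.ofReal (κ n * t) ≤ φ t + ENNReal.ofReal (δ n))
    (P4 : ∀ t, 0 ≤ t → ∀ w : ℝ≥0∞,
        (∀ n, ENNReal.ofReal (κ n * t) ≤ w + ENNReal.ofReal (δ n)) → φ t ≤ w)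
    (P5 : ∀ n, ENNReal.ofReal (κ n) ≤ K)
    (μ : SignedMeasure ℝ) (f : ℝ → ℝ)
    (hμ : ∀ x y, a ≤ x → x ≤ y → y ≤ b → μ (Ico x y) = f y - f x) :
    rieszVarC φ a b f ≤ (∫⁻ x in Set.Icc a b, φ |SignedMeasure.rnDeriv μ volume x|)
          + K * SignedMeasure.totalVariation (SignedMeasure.singularPart μ volume)
              (Set.Icc a b) := by
  set g := SignedMeasure.rnDeriv μ volume with hg
  have hgm : Measurable g := SignedMeasure.measurable_rnDeriv μ volume
  set σ := SignedMeasure.singularPart μ volume with hσ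
  set m : Measure ℝ := volume.withDensity (fun x => φ |g x|) + K • σ.totalVariation with hm
  have hmA : ∀ A, MeasurableSet A →
      m A = (∫⁻ x in A, φ |g x|) + K * σ.totalVariation A := by
    intro A hA
    rw [hm, Measure.add_apply, withDensity_apply _ hA, Measure.smul_apply, smul_eq_mul]
  rw [← hmA _ measurableSet_Icc]
  have step : ∀ x y, a ≤ x → x < y → y ≤ b →
      φ (|f y - f x| / (y - x)) * ENNReal.ofReal (y - x) ≤ m (Ico x y) := by
    intro x y hx hxy hy
    have hpos : 0 < y - x := sub_pos.2 hxy
    have hne : ENNReal.ofReal (y - x) ≠ 0 := by simp [hxy]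
    rw [← ENNReal.le_div_iff_mul_le (Or.inl hne) (Or.inl ENNReal.ofReal_ne_top)]
    refine P4 _ (by positivity) _ fun n => ?_
    have key : ENNReal.ofReal (κ n * |f y - f x|) ≤
        m (Ico x y) + ENNReal.ofReal (δ n) * ENNReal.ofReal (y - x) := by
      rw [← hμ x y hx hxy.le hy, ENNReal.ofReal_mul (hκ n), hmA _ measurableSet_Ico]
      refine (mul_le_mul_right (rv_abs_le μ measurableSet_Ico) _).trans ?_
      rw [mul_add, add_right_comm]
      refine add_le_add ?_ (mul_le_mul_left (P5 n) _)
      rw [← lintegral_const_mul _ (by fun_prop), ← Real.volume_Ico, ← setLIntegral_const,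
        ← lintegral_add_right _ measurable_const]
      refine lintegral_mono fun z => ?_
      simp only
      rw [← ENNReal.ofReal_mul (hκ n)]
      exact P3 n _ (abs_nonneg _)
    rw [← mul_div_assoc, ENNReal.ofReal_div_of_pos hpos]
    refine (ENNReal.div_le_div_right key _).trans ?_
    rw [← ENNReal.div_add_div_same, ENNReal.mul_div_cancel_right hne ENNReal.ofReal_ne_top]
  refine iSup_le fun P => ?_
  have hle : ∀ i j, i ≤ j → j ≤ P.n → P.x i ≤ P.x j := by
    intro i j hij
    induction j, hij using Nat.le_induction with
    | base => intro _; exact le_rfl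
    | succ j hij ih => intro hj; exact (ih (by omega)).trans (P.strict j (by omega)).le
  calc vSumC φ f P ≤ ∑ k ∈ Finset.range P.n, m (Ico (P.x k) (P.x (k + 1))) := by
        refine Finset.sum_le_sum fun k hk => ?_
        have hk := Finset.mem_range.1 hk
        refine step _ _ ?_ (P.strict k hk) ?_
        · exact P.left.symm.le.trans (hle 0 k (Nat.zero_le _) hk.le)
        · exact (hle (k + 1) P.n hk le_rfl).trans P.right.le
    _ = m (Ico a b) := by
        rw [(rv_sum_Ico m P.x P.n P.strict).2, P.left, P.right]
    _ ≤ m (Icc a b) := measure_mono Ico_subset_Icc_self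

/-- **Orlicz case, `K < ∞`** (Corollary 1.4(1)).  If `φ ∈ Φ_c` is independent of `x`,
`K = lim_{t→∞} φ(t)/t < ∞`, `f` is left-continuous and `V^φ_I(f) < ∞`, then `f ∈ BV(I)`
(its derivative is a signed measure `Df`) and
`V^φ_I(f) = ∫_I φ(|f'|) dx + K |D^s f|(I)`. -/
theorem riesz_variation_orlicz_finite_slope (a b : ℝ) (hab : a < b)
    (φ : ℝ → ℝ≥0∞) (hφ : IsPhiC φ)
    (K : ℝ≥0∞) (hK : Tendsto (fun t : ℝ => φ t / ENNReal.ofReal t) atTop (nhds K))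
    (hKfin : K ≠ ⊤)
    (f : ℝ → ℝ) (hlc : LeftContOn f a b)
    (hfin : rieszVarC φ a b f ≠ ⊤) :
    ∃ μ : MeasureTheory.SignedMeasure ℝ, IsDerivMeasure f a b μ ∧
      rieszVarC φ a b f
        = (∫⁻ x in Set.Icc a b, φ |SignedMeasure.rnDeriv μ volume x|)
          + K * SignedMeasure.totalVariation (SignedMeasure.singularPart μ volume)
              (Set.Icc a b) := by
  obtain ⟨κ, δ, hκ, hδ, P3, P4, P5, P6, hpos⟩ := rv_phi_affine φ hφ K hK hKfin
  set pr : ℝ → ℝ := fun z => max a (min z b) with hpr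
  have pra : ∀ z, a ≤ pr z := fun z => le_max_left _ _
  have prb : ∀ z, pr z ≤ b := fun z => max_le hab.le (min_le_right _ _)
  have prmono : Monotone pr := fun x y hxy => max_le_max_left _ (min_le_min_right _ hxy)
  have prid : ∀ z, a ≤ z → z ≤ b → pr z = z := fun z h1 h2 => by
    simp [hpr, min_eq_left h2, max_eq_right h1]
  have prlip : ∀ x y, x ≤ y → pr y - pr x ≤ y - x := by
    intro x y hxy
    simp only [hpr]
    rcases max_cases a (min y b) with ⟨h1, h1'⟩ | ⟨h1, h1'⟩ <;>
    rcases max_cases a (min x b) with ⟨h2, h2'⟩ | ⟨h2, h2'⟩ <;>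
    rcases min_cases x b with ⟨h3, h3'⟩ | ⟨h3, h3'⟩ <;>
    rcases min_cases y b with ⟨h4, h4'⟩ | ⟨h4, h4'⟩ <;> linarith
  set V : ℝ → ℝ≥0∞ := fun x => rieszVarC φ a x f with hV
  have hVsup : ∀ x y, a ≤ x → x < y →
      V x + φ (|f y - f x| / (y - x)) * ENNReal.ofReal (y - x) ≤ V y :=
    fun x y hx hxy => rv_superadd φ f hx hxy
  have hVmono : ∀ x y, a ≤ x → x ≤ y → V x ≤ V y := by
    intro x y hx hxy
    rcases hxy.eq_or_lt with rfl | h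
    · exact le_rfl
    · exact le_self_add.trans (hVsup x y hx h)
  have hVfin : ∀ x, V (pr x) ≠ ⊤ := fun x =>
    ne_top_of_le_ne_top hfin (hVmono _ _ (pra x) (prb x))
  set W : ℝ → ℝ := fun x => (V (pr x)).toReal with hWdef
  set F : ℝ → ℝ := fun x => f (pr x) with hFdef
  have hW : Monotone W := fun x y hxy =>
    ENNReal.toReal_mono (hVfin y) (hVmono _ _ (pra x) (prmono hxy))
  have hF : ∀ x, Tendsto F (nhdsWithin x (Iio x)) (nhds (F x)) := by
    intro x
    rcases le_or_gt x a with hxa | hxa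
    · refine tendsto_const_nhds.congr' (f₁ := fun _ => F x) ?_
      filter_upwards [self_mem_nhdsWithin] with z hz
      have hz : z < x := hz
      have h1 : pr x = a := by
        simp [hpr, hxa]
      have h2 : pr z = a := by
        simp [hpr, hz.le.trans hxa]
      simp only [hFdef, h1, h2]
    rcases le_or_gt x b with hxb | hxb
    · have hx : F x = f x := by simp only [hFdef, prid x hxa.le hxb]
      rw [hx]
      refine (hlc x ⟨hxa, hxb⟩).congr' ?_
      filter_upwards [Ioo_mem_nhdsLT hxa] with z hz
      simp only [hFdef, prid z hz.1.le (hz.2.le.trans hxb)]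
    · refine tendsto_const_nhds.congr' (f₁ := fun _ => F x) ?_
      filter_upwards [Ioo_mem_nhdsLT hxb] with z hz
      have h1 : pr x = b := by
        simp [hpr, hxb.le, hab.le]
      have h2 : pr z = b := by
        simp [hpr, hz.1.le, hab.le]
      simp only [hFdef, h1, h2]
  have hmon : ∀ n x y, x ≤ y → κ n * |F y - F x| ≤ W y - W x + δ n * (y - x) := by
    intro n x y hxy
    have hd := mul_le_mul_of_nonneg_left (prlip x y hxy) (hδ n)
    rcases (prmono hxy).eq_or_lt with he | hlt
    · have : F y = F x := by simp only [hFdef, he]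
      have h2 : W y = W x := by simp only [hWdef, he]
      rw [this, h2]
      simp only [sub_self, abs_zero, mul_zero, zero_add]
      exact mul_nonneg (hδ n) (sub_nonneg.2 hxy)
    · have hp : 0 < pr y - pr x := sub_pos.2 hlt
      have h1 := hVsup _ _ (pra x) hlt
      have h3 := P3 n (|f (pr y) - f (pr x)| / (pr y - pr x)) (by positivity)
      have h4 : ENNReal.ofReal (κ n * |F y - F x|) ≤
          φ (|f (pr y) - f (pr x)| / (pr y - pr x)) * ENNReal.ofReal (pr y - pr x)
            + ENNReal.ofReal (δ n * (pr y - pr x)) := by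
        have := mul_le_mul_left h3 (ENNReal.ofReal (pr y - pr x))
        rw [add_mul, ← ENNReal.ofReal_mul (hδ n), ← ENNReal.ofReal_mul
          (mul_nonneg (hκ n) (by positivity)), mul_assoc, div_mul_cancel₀ _ hp.ne'] at this
        exact this
      have h5 : V (pr x) + ENNReal.ofReal (κ n * |F y - F x|) ≤
          V (pr y) + ENNReal.ofReal (δ n * (pr y - pr x)) := by
        refine (add_le_add_right h4 _).trans ?_
        rw [← add_assoc]
        exact add_le_add_left h1 _
      have h6 := ENNReal.toReal_mono
        (ENNReal.add_ne_top.2 ⟨hVfin y, ENNReal.ofReal_ne_top⟩) h5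
      rw [ENNReal.toReal_add (hVfin x) ENNReal.ofReal_ne_top,
        ENNReal.toReal_add (hVfin y) ENNReal.ofReal_ne_top,
        ENNReal.toReal_ofReal (mul_nonneg (hκ n) (abs_nonneg _)),
        ENNReal.toReal_ofReal (mul_nonneg (hδ n) hp.le)] at h6
      change W x + _ ≤ W y + _ at h6
      linarith
  obtain ⟨μ, hμ, hC⟩ := rv_construct a b W F hW hF κ δ hκ hδ hmon hpos
  have hμf : ∀ x y, a ≤ x → x ≤ y → y ≤ b → μ (Ico x y) = f y - f x := by
    intro x y hx hxy hy
    rw [hμ x y hx hxy hy]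
    simp only [hFdef, prid x hx (hxy.trans hy), prid y (hx.trans hxy) hy]
  refine ⟨μ, fun x hx => by rw [hμf a x le_rfl hx.1 hx.2]; ring, le_antisymm ?_ ?_⟩
  · exact rv_upper a b φ K κ δ hκ hδ P3 P4 P5 μ f hμf
  · have : IsFiniteMeasure ((rvM hW).restrict (Ico a b)) := ⟨by
      rw [Measure.restrict_apply_univ]; exact measure_Ico_lt_top⟩
    have h1 := rv_lower φ K κ δ hκ P4 P6 μ ((rvM hW).restrict (Ico a b)) hC
    refine le_trans (add_le_add (setLIntegral_le_lintegral _ _)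
      (mul_le_mul_right (measure_mono (subset_univ _)) _)) (h1.trans ?_)
    rw [Measure.restrict_apply_univ, rvM_Ico]
    refine ENNReal.ofReal_le_of_le_toReal ?_
    have e1 : Function.leftLim W b ≤ (rieszVarC φ a b f).toReal := by
      refine (hW.leftLim_le le_rfl).trans (le_of_eq ?_)
      simp only [hWdef, hV, prid b hab.le le_rfl]
    have e2 : 0 ≤ Function.leftLim W a :=
      le_trans (show 0 ≤ W (a - 1) from ENNReal.toReal_nonneg)
        (hW.le_leftLim (by linarith))
    linarith
end

section
/- Let I=[a,b]⊂ℝ be a closed nondegenerate interval, let φ∈Φ_c be independent of x, and suppose lim_{t→∞} φ(t)/t = ∞. If f:I→ℝ satisfies V^φ_I(f)<∞, then f is absolutely continuous on I and V^φ_I(f) = ∫_I φ(|f'(x)|) dx. -/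
open MeasureTheory Filter Set
open scoped ENNReal

namespace RieszAux

lemma sum_le_of_step (W : ℝ → ℝ≥0∞) (n : ℕ) (x : ℕ → ℝ) (g : ℕ → ℝ≥0∞)
    (h : ∀ k < n, g k + W (x k) ≤ W (x (k + 1))) :
    ∑ k ∈ Finset.range n, g k ≤ W (x n) := by
  induction n with
  | zero => simp
  | succ n ih =>
    rw [Finset.sum_range_succ, add_comm]
    exact le_trans (by gcongr; exact ih fun k hk => h k (by omega)) (h n (by omega))

lemma sum_disj_le (W : ℝ → ℝ≥0∞) (a b : ℝ) (hW : MonotoneOn W (Icc a b)) (s t : ℕ → ℝ)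
    (g : ℕ → ℝ≥0∞) (F : Finset ℕ)
    (hst : ∀ i ∈ F, a ≤ s i ∧ s i < t i)
    (hd : ∀ i ∈ F, ∀ j ∈ F, i ≠ j → t i ≤ s j ∨ t j ≤ s i)
    (hg : ∀ i ∈ F, g i + W (s i) ≤ W (t i)) :
    ∀ d ∈ Icc a b, (∀ i ∈ F, t i ≤ d) → ∑ i ∈ F, g i ≤ W d := by
  classical
  induction F using Finset.induction_on_max_value t with
  | empty => simp
  | insert i F hi hmax ih =>
    intro d hdab htd
    rw [Finset.sum_insert hi]
    have h1 := hst i (Finset.mem_insert_self _ _)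
    have h2 := htd i (Finset.mem_insert_self _ _)
    have h3 : ∑ j ∈ F, g j ≤ W (s i) := by
      refine ih (fun j hj => hst j (Finset.mem_insert_of_mem hj))
        (fun j hj k hk => hd j (Finset.mem_insert_of_mem hj) k (Finset.mem_insert_of_mem hk))
        (fun j hj => hg j (Finset.mem_insert_of_mem hj)) (s i)
        ⟨h1.1, by linarith [hdab.2]⟩ ?_
      intro j hj
      have hne : i ≠ j := by rintro rfl; exact hi hj
      rcases hd i (Finset.mem_insert_self _ _) j (Finset.mem_insert_of_mem hj) hne with h | h
      · have := hmax j hj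
        have := (hst j (Finset.mem_insert_of_mem hj)).2
        linarith
      · exact h
    calc g i + ∑ j ∈ F, g j ≤ g i + W (s i) := by gcongr
      _ ≤ W (t i) := hg i (Finset.mem_insert_self _ _)
      _ ≤ W d := hW ⟨by linarith, by linarith [hdab.2]⟩ hdab h2

/-- Append a point to a partition. -/
noncomputable def snoc {a s : ℝ} (P : IntervalPartition a s) (t : ℝ) (h : s < t) : IntervalPartition a t where
  n := P.n + 1
  npos := by omega
  x := fun i => if i ≤ P.n then P.x i else t
  left := by simp [P.left]
  right := by simp
  strict := by
    intro i hi
    rcases Nat.lt_or_ge i P.n with h1 | h1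
    · have := P.strict i h1
      simp [h1.le, Nat.succ_le_of_lt h1, this]
    · have : i = P.n := by omega
      subst this
      simp [P.right, h]

/-- One-interval partition. -/
noncomputable def single (a t : ℝ) (h : a < t) : IntervalPartition a t where
  n := 1
  npos := by omega
  x := fun i => if i = 0 then a else t
  left := by simp
  right := by simp
  strict := by
    intro i hi
    have : i = 0 := by omega
    subst this
    simp [h]

lemma step (φ : ℝ → ℝ≥0∞) (f : ℝ → ℝ) (a s t : ℝ) (has : a ≤ s) (hst : s < t) :
    φ (|f t - f s| / (t - s)) * ENNReal.ofReal (t - s) + rieszVarC φ a s f ≤ rieszVarC φ a t f := by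
  rcases has.eq_or_lt with rfl | has
  · have h0 : rieszVarC φ a a f = 0 := by
      have : IsEmpty (IntervalPartition a a) := by
        refine ⟨fun P => ?_⟩
        have hm : ∀ k, k < P.n → P.x 0 < P.x (k + 1) := by
          intro k
          induction k with
          | zero => exact fun h => P.strict 0 h
          | succ k ih => exact fun h => (ih (by omega)).trans (P.strict _ h)
        have := hm (P.n - 1) (by have := P.npos; omega)
        rw [Nat.sub_add_cancel P.npos, P.left, P.right] at this
        exact lt_irrefl _ this
      simp [rieszVarC]
    rw [h0, add_zero]
    refine le_trans ?_ (le_iSup _ (single a t hst))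
    simp [vSumC, single]
  · unfold rieszVarC
    have : Nonempty (IntervalPartition a s) := ⟨single a s has⟩
    rw [ENNReal.add_iSup]
    refine iSup_le fun P => le_trans ?_ (le_iSup _ (snoc P t hst))
    unfold vSumC
    have hn : (snoc P t hst).n = P.n + 1 := rfl
    rw [hn, Finset.sum_range_succ, add_comm]
    refine add_le_add (Finset.sum_le_sum fun k hk => ?_) ?_
    · have hk' : k < P.n := Finset.mem_range.1 hk
      simp [snoc, hk'.le, Nat.succ_le_of_lt hk']
    · simp [snoc, P.right]

lemma var_mono (φ : ℝ → ℝ≥0∞) (f : ℝ → ℝ) (a b : ℝ) :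
    MonotoneOn (fun x => rieszVarC φ a x f) (Icc a b) := by
  intro x hx y hy hxy
  rcases hxy.eq_or_lt with rfl | h
  · exact le_rfl
  · exact le_trans le_add_self (step φ f a x y hx.1 h)

lemma absCont (a b : ℝ) (hab : a < b)
    (φ : ℝ → ℝ≥0∞)
    (hK : Tendsto (fun t : ℝ => φ t / ENNReal.ofReal t) atTop (nhds ⊤))
    (f : ℝ → ℝ) (hfin : rieszVarC φ a b f ≠ ⊤) : AbsContOn f a b := by
  intro ε hε
  set V := (rieszVarC φ a b f).toReal with hV
  have hV0 : 0 ≤ V := ENNReal.toReal_nonneg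
  set K : ℝ := 2 * (V + 1) / ε with hKdef
  have hK0 : 0 < K := by positivity
  obtain ⟨T, hT⟩ := ((hK.eventually (lt_mem_nhds (ENNReal.ofReal_lt_top (r := K)))).and
    (eventually_gt_atTop 0)).exists_forall_of_atTop
  have hT0 : 0 < T := (hT T le_rfl).2
  have hTK : ∀ t, T ≤ t → ENNReal.ofReal (K * t) ≤ φ t := by
    intro t ht
    have h1 := (hT t ht).1.le
    have ht0 : 0 < t := (hT t ht).2
    rw [ENNReal.le_div_iff_mul_le (Or.inl (by simpa using ht0)) (Or.inl ENNReal.ofReal_ne_top),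
      ← ENNReal.ofReal_mul hK0.le] at h1
    exact h1
  refine ⟨ε / (2 * T), by positivity, ?_⟩
  intro m s t hst hd hlen
  set g : ℕ → ℝ≥0∞ := fun i => φ (|f (t i) - f (s i)| / (t i - s i)) * ENNReal.ofReal (t i - s i)
    with hgdef
  set F := (Finset.range m).filter (fun i => s i < t i) with hF
  have hsum : ∑ i ∈ F, g i ≤ rieszVarC φ a b f := by
    refine sum_disj_le (fun x => rieszVarC φ a x f) a b (var_mono φ f a b) s t g F ?_ ?_ ?_ b
      ⟨hab.le, le_rfl⟩ ?_
    · intro i hi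
      simp only [hF, Finset.mem_filter, Finset.mem_range] at hi
      exact ⟨(hst i hi.1).1, hi.2⟩
    · intro i hi j hj hij
      simp only [hF, Finset.mem_filter, Finset.mem_range] at hi hj
      rcases lt_or_gt_of_ne hij with h | h
      · exact hd i j h hj.1
      · exact (hd j i h hi.1).symm
    · intro i hi
      simp only [hF, Finset.mem_filter, Finset.mem_range] at hi
      exact step φ f a (s i) (t i) (hst i hi.1).1 hi.2
    · intro i hi
      simp only [hF, Finset.mem_filter, Finset.mem_range] at hi
      exact (hst i hi.1).2.2
  have hterm : ∀ i ∈ F, ENNReal.ofReal (K * |f (t i) - f (s i)|) ≤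
      ENNReal.ofReal (K * T * (t i - s i)) + g i := by
    intro i hi
    simp only [hF, Finset.mem_filter, Finset.mem_range] at hi
    have hl : 0 < t i - s i := by linarith [hi.2]
    rcases le_total T (|f (t i) - f (s i)| / (t i - s i)) with h | h
    · refine le_trans ?_ le_add_self
      calc ENNReal.ofReal (K * |f (t i) - f (s i)|)
          = ENNReal.ofReal (K * (|f (t i) - f (s i)| / (t i - s i))) *
            ENNReal.ofReal (t i - s i) := by
            rw [← ENNReal.ofReal_mul (by positivity)]
            congr 1
            field_simp
        _ ≤ g i := by
            simp only [hgdef]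
            gcongr
            exact hTK _ h
    · refine le_trans (ENNReal.ofReal_le_ofReal ?_) le_self_add
      rw [div_le_iff₀ hl] at h
      nlinarith
  have hsumF1 : ∑ i ∈ Finset.range m, |f (t i) - f (s i)| = ∑ i ∈ F, |f (t i) - f (s i)| := by
    symm
    refine Finset.sum_subset (Finset.filter_subset _ _) fun i hi hi' => ?_
    simp only [hF, Finset.mem_filter, not_and, not_lt] at hi'
    have : s i = t i := le_antisymm (hst i (Finset.mem_range.1 hi)).2.1 (hi' hi)
    simp [this]
  have hsumF2 : ∑ i ∈ Finset.range m, (t i - s i) = ∑ i ∈ F, (t i - s i) := by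
    symm
    refine Finset.sum_subset (Finset.filter_subset _ _) fun i hi hi' => ?_
    simp only [hF, Finset.mem_filter, not_and, not_lt] at hi'
    have : s i = t i := le_antisymm (hst i (Finset.mem_range.1 hi)).2.1 (hi' hi)
    simp [this]
  rw [hsumF1]
  rw [hsumF2] at hlen
  have hpos : ∀ i ∈ F, 0 ≤ t i - s i := by
    intro i hi
    simp only [hF, Finset.mem_filter, Finset.mem_range] at hi
    linarith [hi.2]
  have hpos' : 0 ≤ ∑ i ∈ F, (t i - s i) := Finset.sum_nonneg hpos
  have htot : ENNReal.ofReal (K * ∑ i ∈ F, |f (t i) - f (s i)|) ≤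
      ENNReal.ofReal (K * T * ∑ i ∈ F, (t i - s i) + V) := by
    rw [ENNReal.ofReal_add (by positivity) hV0, hV, ENNReal.ofReal_toReal hfin]
    rw [Finset.mul_sum, Finset.mul_sum, ENNReal.ofReal_sum_of_nonneg (fun i _ => by positivity),
      ENNReal.ofReal_sum_of_nonneg (fun i hi => by have := hpos i hi; positivity)]
    calc _ ≤ ∑ i ∈ F, (ENNReal.ofReal (K * T * (t i - s i)) + g i) := Finset.sum_le_sum hterm
      _ = _ := Finset.sum_add_distrib
      _ ≤ _ := by gcongr
  rw [ENNReal.ofReal_le_ofReal_iff (by positivity)] at htot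
  have h1 : K * T * ∑ i ∈ F, (t i - s i) ≤ K * (ε / 2) := by
    have : T * ∑ i ∈ F, (t i - s i) ≤ T * (ε / (2 * T)) := by gcongr
    have h2 : T * (ε / (2 * T)) = ε / 2 := by field_simp
    rw [mul_assoc]
    gcongr
    linarith
  have h2 : K * (ε / 2) = V + 1 := by rw [hKdef]; field_simp
  have h3 : K * ∑ i ∈ F, |f (t i) - f (s i)| < K * ε := by
    have : K * ε = K * (ε / 2) + K * (ε / 2) := by ring
    linarith
  exact lt_of_mul_lt_mul_left h3 hK0.le

lemma toMathlib (a b : ℝ) (hab : a < b) (f : ℝ → ℝ) (h : AbsContOn f a b) :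
    AbsolutelyContinuousOnInterval f a b := by
  rw [absolutelyContinuousOnInterval_iff]
  intro ε hε
  obtain ⟨δ, hδ, H⟩ := h ε hε
  refine ⟨δ, hδ, ?_⟩
  rintro ⟨m, E⟩ ⟨hE1, hE2⟩ hlen
  simp only [uIcc_of_le hab.le] at hE1 hE2 hlen ⊢
  -- degenerate intervals are moved to the left endpoint
  have key := H m (fun i => if (E i).1 = (E i).2 then a else min (E i).1 (E i).2)
    (fun i => if (E i).1 = (E i).2 then a else max (E i).1 (E i).2) ?_ ?_ ?_
  · refine lt_of_eq_of_lt (Finset.sum_congr rfl fun i hi => ?_) key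
    by_cases h : (E i).1 = (E i).2
    · simp [h]
    · rcases le_total (E i).1 (E i).2 with h' | h'
      · simp [h, h', Real.dist_eq, abs_sub_comm]
      · simp [h, h', Real.dist_eq]
  · intro i hi
    have := hE1 i (Finset.mem_range.2 hi)
    simp only [mem_Icc] at this
    by_cases h : (E i).1 = (E i).2
    · simp [h, hab.le]
    · simp [h]
      grind
  · intro i j hij hj
    have hi := hE1 i (Finset.mem_range.2 (hij.trans hj))
    have hj' := hE1 j (Finset.mem_range.2 hj)
    have hdis := hE2 (Finset.mem_coe.2 (Finset.mem_range.2 (hij.trans hj)))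
      (Finset.mem_coe.2 (Finset.mem_range.2 hj)) hij.ne
    simp only [mem_Icc] at hi hj'
    by_cases h : (E i).1 = (E i).2
    · left
      simp only [h, if_true]
      split_ifs
      · exact le_rfl
      · exact le_min hj'.1.1 hj'.2.1
    · by_cases h' : (E j).1 = (E j).2
      · right
        simp only [h, h', if_true, if_false]
        exact le_min hi.1.1 hi.2.1
      · simp only [h, h', if_false]
        by_contra! hc
        have hp : min (max (E i).1 (E i).2) (max (E j).1 (E j).2) ∈
            uIoc (E i).1 (E i).2 := by
          simp only [uIoc, mem_Ioc]
          refine ⟨lt_min ?_ hc.2, min_le_left _ _⟩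
          simpa [eq_comm] using h
        have hq : min (max (E i).1 (E i).2) (max (E j).1 (E j).2) ∈
            uIoc (E j).1 (E j).2 := by
          simp only [uIoc, mem_Ioc]
          refine ⟨lt_min hc.1 ?_, min_le_right _ _⟩
          simpa [eq_comm] using h'
        exact Set.disjoint_left.1 hdis hp hq
  · refine lt_of_eq_of_lt (Finset.sum_congr rfl fun i hi => ?_) hlen
    by_cases h : (E i).1 = (E i).2
    · simp [h]
    · simp [h, Real.dist_eq, max_sub_min_eq_abs']

lemma meas_phi (φ : ℝ → ℝ≥0∞) (hφ : IsPhiC φ) (g : ℝ → ℝ) (hg : Measurable g)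
    (hg0 : ∀ x, 0 ≤ g x) : Measurable fun x => φ (g x) := by
  have h : Monotone fun t => φ (max t 0) := fun x y hxy =>
    hφ.mono (mem_Ici.2 (le_max_right _ _)) (mem_Ici.2 (le_max_right _ _)) (max_le_max_right _ hxy)
  have := h.measurable.comp hg
  convert this using 2 with x
  simp [hg0 x]

/-- Below any value `φ t`, there is some `φ s` with `s < t`. -/
lemma exists_lt (φ : ℝ → ℝ≥0∞) (hφ : IsPhiC φ) (t : ℝ) (ht : 0 ≤ t) (y : ℝ≥0∞) (hy : y < φ t) :
    ∃ s, 0 < s ∧ s < t ∧ y < φ s := by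
  have ht0 : 0 < t := by
    rcases ht.eq_or_lt with rfl | h
    · rw [hφ.map_zero] at hy; exact absurd hy not_lt_zero
    · exact h
  have h1 := (hφ.leftCont t ht0).eventually (lt_mem_nhds hy)
  have h2 : ∀ᶠ s in nhdsWithin t (Iio t), s ∈ Ioo 0 t := Ioo_mem_nhdsLT ht0
  obtain ⟨s, hs1, hs2⟩ := (h1.and h2).exists
  exact ⟨s, hs2.1, hs2.2, hs1⟩

lemma conv_real (φ : ℝ → ℝ≥0∞) (hφ : IsPhiC φ) (u s t : ℝ) (hu : 0 ≤ u) (hus : u < s)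
    (hst : s < t) (ht : φ t ≠ ⊤) :
    ((φ s).toReal - (φ u).toReal) / (s - u) ≤ ((φ t).toReal - (φ s).toReal) / (t - s) := by
  have hu' : φ u ≠ ⊤ := ne_top_of_le_ne_top ht
    (hφ.mono hu (show (0:ℝ) ≤ t by linarith) (by linarith))
  have hut : 0 < t - u := by linarith
  have h := hφ.convex u t ((t - s) / (t - u)) hu (by linarith)
    (div_nonneg (by linarith) hut.le) ((div_le_one hut).2 (by linarith))
  have e1 : (t - s) / (t - u) * u + (1 - (t - s) / (t - u)) * t = s := by field_simp; ring
  have e2 : 1 - (t - s) / (t - u) = (s - u) / (t - u) := by field_simp; ring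
  rw [e1, e2] at h
  have h' := ENNReal.toReal_mono (by finiteness) h
  rw [ENNReal.toReal_add (by finiteness) (by finiteness), ENNReal.toReal_mul, ENNReal.toReal_mul,
    ENNReal.toReal_ofReal (div_nonneg (by linarith) hut.le),
    ENNReal.toReal_ofReal (div_nonneg (by linarith) hut.le)] at h'
  have h2 : (t - u) * (φ s).toReal ≤ (t - s) * (φ u).toReal + (s - u) * (φ t).toReal := by
    have := mul_le_mul_of_nonneg_left h' hut.le
    refine this.trans_eq ?_
    field_simp
  rw [div_le_div_iff₀ (by linarith) (by linarith)]
  nlinarith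

/-- Supporting line. -/
lemma support (φ : ℝ → ℝ≥0∞) (hφ : IsPhiC φ) (s T : ℝ) (hs : 0 < s) (hsT : s < T)
    (hT : φ T ≠ ⊤) :
    ∃ k : ℝ, 0 ≤ k ∧ ∀ t, 0 ≤ t →
      φ s + ENNReal.ofReal (k * t) ≤ φ t + ENNReal.ofReal (k * s) := by
  have hs' : φ s ≠ ⊤ := ne_top_of_le_ne_top hT (hφ.mono hs.le (show (0:ℝ) ≤ T by linarith) hsT.le)
  set A : Set ℝ := (fun u => ((φ s).toReal - (φ u).toReal) / (s - u)) '' Ico 0 s with hA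
  have hne : A.Nonempty := ⟨_, 0, ⟨le_rfl, hs⟩, rfl⟩
  have hub : ∀ t, s < t → φ t ≠ ⊤ → ∀ y ∈ A, y ≤ ((φ t).toReal - (φ s).toReal) / (t - s) := by
    rintro t hst ht _ ⟨u, hu, rfl⟩
    exact conv_real φ hφ u s t hu.1 hu.2 hst ht
  have hbdd : BddAbove A := ⟨_, hub T hsT hT⟩
  have hk0 : 0 ≤ sSup A := by
    refine le_trans ?_ (le_csSup hbdd ⟨0, ⟨le_rfl, hs⟩, rfl⟩)
    simp only [hφ.map_zero, ENNReal.toReal_zero, sub_zero]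
    positivity
  refine ⟨sSup A, hk0, fun t ht => ?_⟩
  by_cases htop : φ t = ⊤
  · simp [htop]
  have hreal : (φ s).toReal + sSup A * t ≤ (φ t).toReal + sSup A * s := by
    rcases lt_trichotomy t s with h | h | h
    · have := le_csSup hbdd ⟨t, ⟨ht, h⟩, rfl⟩
      simp only at this
      rw [div_le_iff₀ (by linarith)] at this
      linarith
    · rw [h]
    · have := csSup_le hne (hub t h htop)
      rw [le_div_iff₀ (by linarith)] at this
      linarith
  calc φ s + ENNReal.ofReal (sSup A * t)
      = ENNReal.ofReal ((φ s).toReal + sSup A * t) := by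
        rw [ENNReal.ofReal_add (by positivity) (by positivity), ENNReal.ofReal_toReal hs']
    _ ≤ ENNReal.ofReal ((φ t).toReal + sSup A * s) := ENNReal.ofReal_le_ofReal hreal
    _ = _ := by
        rw [ENNReal.ofReal_add (by positivity) (by positivity), ENNReal.ofReal_toReal htop]

lemma jensen (φ : ℝ → ℝ≥0∞) (hφ : IsPhiC φ) (c d : ℝ) (hcd : c < d) (g : ℝ → ℝ)
    (hg : Measurable g) (hg0 : ∀ x, 0 ≤ g x) (m : ℝ) (hm : 0 ≤ m)
    (hmg : ENNReal.ofReal (m * (d - c)) ≤ ∫⁻ x in Ioc c d, ENNReal.ofReal (g x)) :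
    φ m * ENNReal.ofReal (d - c) ≤ ∫⁻ x in Ioc c d, φ (g x) := by
  have hL : 0 < d - c := by linarith
  have hL0 : ENNReal.ofReal (d - c) ≠ 0 := by simpa using hcd
  rw [← ENNReal.le_div_iff_mul_le (Or.inl hL0) (Or.inl ENNReal.ofReal_ne_top)]
  refine le_of_forall_lt fun y hy => ?_
  obtain ⟨s, hs0, hsm, hys⟩ := exists_lt φ hφ m hm y hy
  refine lt_of_lt_of_le hys ?_
  rw [ENNReal.le_div_iff_mul_le (Or.inl hL0) (Or.inl ENNReal.ofReal_ne_top)]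
  by_cases hT : ∃ T, s < T ∧ φ T ≠ ⊤
  · obtain ⟨T, hsT, hT⟩ := hT
    obtain ⟨k, hk0, hk⟩ := support φ hφ s T hs0 hsT hT
    have hint : ∫⁻ x in Ioc c d, (φ s + ENNReal.ofReal (k * g x)) ≤
        ∫⁻ x in Ioc c d, (φ (g x) + ENNReal.ofReal (k * s)) :=
      lintegral_mono fun x => hk (g x) (hg0 x)
    rw [lintegral_add_left measurable_const, lintegral_add_right _ measurable_const] at hint
    simp only [lintegral_const, Measure.restrict_apply_univ, Real.volume_Ioc] at hint
    have e : ∫⁻ x in Ioc c d, ENNReal.ofReal (k * g x) =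
        ENNReal.ofReal k * ∫⁻ x in Ioc c d, ENNReal.ofReal (g x) := by
      rw [← lintegral_const_mul _ hg.ennreal_ofReal]
      simp_rw [ENNReal.ofReal_mul hk0]
    rw [e] at hint
    have h2 : ENNReal.ofReal (k * s) * ENNReal.ofReal (d - c) ≤
        ENNReal.ofReal k * ∫⁻ x in Ioc c d, ENNReal.ofReal (g x) := by
      calc ENNReal.ofReal (k * s) * ENNReal.ofReal (d - c)
          = ENNReal.ofReal k * ENNReal.ofReal (s * (d - c)) := by
            rw [← ENNReal.ofReal_mul (by positivity), ← ENNReal.ofReal_mul hk0, mul_assoc]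
        _ ≤ ENNReal.ofReal k * ENNReal.ofReal (m * (d - c)) := by gcongr
        _ ≤ _ := by gcongr
    have h3 := (add_le_add_right h2 (φ s * ENNReal.ofReal (d - c))).trans hint
    exact (ENNReal.add_le_add_iff_right (by finiteness)).1 h3
  · push Not at hT
    by_cases hfin : ∫⁻ x in Ioc c d, φ (g x) = ⊤
    · rw [hfin]; exact le_top
    exfalso
    have h1 := ae_lt_top (meas_phi φ hφ g hg hg0) hfin
    have h2 : ∫⁻ x in Ioc c d, ENNReal.ofReal (g x) ≤ ∫⁻ x in Ioc c d, ENNReal.ofReal s := by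
      refine lintegral_mono_ae ?_
      filter_upwards [h1] with x hx
      refine ENNReal.ofReal_le_ofReal ?_
      by_contra! hc
      exact hx.ne (hT _ hc)
    simp only [lintegral_const, Measure.restrict_apply_univ, Real.volume_Ioc] at h2
    rw [← ENNReal.ofReal_mul hs0.le] at h2
    have h3 := hmg.trans h2
    rw [ENNReal.ofReal_le_ofReal_iff (by positivity)] at h3
    nlinarith

lemma part_mono {a b : ℝ} (P : IntervalPartition a b) :
    ∀ i j, i ≤ j → j ≤ P.n → P.x i ≤ P.x j := by
  intro i j hij
  induction j, hij using Nat.le_induction with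
  | base => exact fun _ => le_rfl
  | succ j hj ih => exact fun h => (ih (by omega)).trans (P.strict j h).le

lemma upper (a b : ℝ) (hab : a < b) (φ : ℝ → ℝ≥0∞) (hφ : IsPhiC φ) (f : ℝ → ℝ)
    (hf : AbsolutelyContinuousOnInterval f a b) :
    rieszVarC φ a b f ≤ ∫⁻ x in Set.Icc a b, φ |deriv f x| := by
  refine iSup_le fun P => ?_
  rw [setLIntegral_congr Ioc_ae_eq_Icc.symm]
  have key := sum_le_of_step (fun y => ∫⁻ x in Ioc a y, φ |deriv f x|) P.n P.x
    (fun k => φ (|f (P.x (k + 1)) - f (P.x k)| / (P.x (k + 1) - P.x k)) *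
      ENNReal.ofReal (P.x (k + 1) - P.x k)) ?_
  · rwa [P.right] at key
  intro k hk
  have h1 : a ≤ P.x k := P.left.symm.le.trans (part_mono P 0 k (by omega) (by omega))
  have h2 : P.x (k + 1) ≤ b := (part_mono P (k + 1) P.n (by omega) le_rfl).trans P.right.le
  have h3 := P.strict k hk
  rw [← Ioc_union_Ioc_eq_Ioc h1 h3.le, lintegral_union measurableSet_Ioc
    (Ioc_disjoint_Ioc_of_le le_rfl), add_comm]
  gcongr
  refine jensen φ hφ _ _ h3 (fun x => |deriv f x|) (measurable_deriv f).norm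
    (fun x => abs_nonneg _) _ (div_nonneg (abs_nonneg _) (by linarith)) ?_
  have hac : AbsolutelyContinuousOnInterval f (P.x k) (P.x (k + 1)) := by
    refine hf.mono ?_
    rw [uIcc_of_le h3.le, uIcc_of_le hab.le]
    exact Icc_subset_Icc h1 h2
  have hint := hac.integral_deriv_eq_sub
  rw [intervalIntegral.integral_of_le h3.le] at hint
  rw [div_mul_cancel₀ _ (by linarith), ← hint]
  have := enorm_integral_le_lintegral_enorm (μ := volume.restrict (Ioc (P.x k) (P.x (k + 1))))
    (deriv f)
  simpa only [Real.enorm_eq_ofReal_abs] using this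

/-- Uniform partition. -/
noncomputable def unif (a b : ℝ) (hab : a < b) (n : ℕ) : IntervalPartition a b where
  n := n + 1
  npos := by omega
  x := fun i => a + i * ((b - a) / (n + 1))
  left := by simp
  right := by push_cast; field_simp; ring
  strict := by
    intro i _
    have : 0 < (b - a) / ((n : ℝ) + 1) := div_pos (by linarith) (by positivity)
    push_cast
    nlinarith

lemma exists_cell (W : ℕ → ℝ) (n : ℕ) (x : ℝ) (h0 : W 0 < x) (hn : x ≤ W n) :
    ∃ k < n, x ∈ Ioc (W k) (W (k + 1)) := by
  induction n with
  | zero => linarith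
  | succ n ih =>
    by_cases h : x ≤ W n
    · obtain ⟨k, hk, hx⟩ := ih h
      exact ⟨k, by omega, hx⟩
    · exact ⟨n, by omega, not_le.1 h, hn⟩

lemma lower (a b : ℝ) (hab : a < b) (φ : ℝ → ℝ≥0∞) (hφ : IsPhiC φ) (f : ℝ → ℝ)
    (hf : AbsolutelyContinuousOnInterval f a b) :
    ∫⁻ x in Set.Icc a b, φ |deriv f x| ≤ rieszVarC φ a b f := by
  rw [setLIntegral_congr Ioc_ae_eq_Icc.symm]
  set c : ℕ → ℕ → ℝ≥0∞ := fun n k => φ (|f ((unif a b hab n).x (k + 1)) - f ((unif a b hab n).x k)| /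
    ((unif a b hab n).x (k + 1) - (unif a b hab n).x k)) with hc
  set G : ℕ → ℝ → ℝ≥0∞ := fun n x => ∑ k ∈ Finset.range (n + 1),
    (Ioc ((unif a b hab n).x k) ((unif a b hab n).x (k + 1))).indicator (fun _ => c n k) x with hG
  have hGm : ∀ n, Measurable (G n) := fun n =>
    Finset.measurable_sum _ fun k _ => measurable_const.indicator measurableSet_Ioc
  have hGint : ∀ n, ∫⁻ x in Ioc a b, G n x ≤ rieszVarC φ a b f := by
    intro n
    refine le_trans ?_ (le_iSup _ (unif a b hab n))
    refine (setLIntegral_le_lintegral _ _).trans ?_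
    simp only [hG]
    rw [lintegral_finsetSum _ fun k _ => measurable_const.indicator measurableSet_Ioc]
    simp only [lintegral_indicator_const measurableSet_Ioc, Real.volume_Ioc]
    exact le_rfl
  have hpt : ∀ᵐ x ∂(volume.restrict (Ioc a b)),
      φ |deriv f x| ≤ liminf (fun n => G n x) atTop := by
    rw [ae_restrict_iff' measurableSet_Ioc]
    filter_upwards [hf.ae_differentiableAt] with x hx hxab
    have hd : HasDerivAt f (deriv f x) x :=
      (hx (by rw [uIcc_of_le hab.le]; exact Ioc_subset_Icc_self hxab)).hasDerivAt
    refine le_of_forall_lt fun y hy => ?_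
    obtain ⟨s, hs0, hsm, hys⟩ := exists_lt φ hφ _ (abs_nonneg _) y hy
    refine lt_of_lt_of_le hys (le_liminf_of_le (by isBoundedDefault) ?_)
    set ε := |deriv f x| - s with hε
    have hε0 : 0 < ε := by linarith
    have hlo := hd.isLittleO.bound hε0
    rw [Metric.eventually_nhds_iff] at hlo
    obtain ⟨δ, hδ, hlo⟩ := hlo
    have hlim : Tendsto (fun n : ℕ => (b - a) / ((n : ℝ) + 1)) atTop (nhds 0) := by
      have := (tendsto_one_div_add_atTop_nhds_zero_nat (𝕜 := ℝ)).const_mul (b - a)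
      simpa [mul_one_div, div_eq_mul_inv] using this
    filter_upwards [hlim.eventually (gt_mem_nhds hδ)] with n hn
    obtain ⟨k, hk, hxk⟩ := exists_cell (unif a b hab n).x (n + 1) x
      (by rw [(unif a b hab n).left]; exact hxab.1)
      (by rw [show n + 1 = (unif a b hab n).n from rfl, (unif a b hab n).right]; exact hxab.2)
    have h1 : c n k ≤ G n x := by
      have := Finset.single_le_sum (s := Finset.range (n + 1)) (f := fun k =>
        (Ioc ((unif a b hab n).x k) ((unif a b hab n).x (k + 1))).indicator (fun _ => c n k) x)
        (fun _ _ => zero_le) (Finset.mem_range.2 hk)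
      refine le_trans ?_ this
      simp only [Set.indicator_of_mem hxk, le_refl]
    refine le_trans ?_ h1
    have hlen : (unif a b hab n).x (k + 1) - (unif a b hab n).x k = (b - a) / ((n : ℝ) + 1) := by
      simp only [unif]; push_cast; ring
    simp only [hc]
    generalize (unif a b hab n).x (k + 1) = v at *
    generalize (unif a b hab n).x k = u at *
    have huv : 0 < v - u := by linarith [hxk.1, hxk.2]
    have hu := hlo (y := u) (by rw [Real.dist_eq, abs_lt]; constructor <;> linarith [hxk.1, hxk.2])
    have hv := hlo (y := v) (by rw [Real.dist_eq, abs_lt]; constructor <;> linarith [hxk.1, hxk.2])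
    refine hφ.mono hs0.le (show (0:ℝ) ≤ _ from div_nonneg (abs_nonneg _) huv.le) ?_
    rw [le_div_iff₀ huv]
    simp only [smul_eq_mul, Real.norm_eq_abs] at hu hv
    rw [abs_of_nonpos (by linarith [hxk.1] : u - x ≤ 0)] at hu
    rw [abs_of_nonneg (by linarith [hxk.2] : 0 ≤ v - x)] at hv
    have e : deriv f x * (v - u) = (f v - f u) + ((f u - f x - (u - x) * deriv f x) -
        (f v - f x - (v - x) * deriv f x)) := by ring
    have e2 : |deriv f x| * (v - u) = |deriv f x * (v - u)| := by
      rw [abs_mul, abs_of_pos huv]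
    have e3 : |deriv f x * (v - u)| ≤ |f v - f u| + (|f u - f x - (u - x) * deriv f x| +
        |f v - f x - (v - x) * deriv f x|) := by
      rw [e]
      exact (abs_add_le _ _).trans (add_le_add_right (abs_sub _ _) _)
    have e4 : s * (v - u) = |deriv f x| * (v - u) - ε * (v - u) := by rw [hε]; ring
    nlinarith
  calc ∫⁻ x in Ioc a b, φ |deriv f x|
      ≤ ∫⁻ x in Ioc a b, liminf (fun n => G n x) atTop := lintegral_mono_ae hpt
    _ ≤ liminf (fun n => ∫⁻ x in Ioc a b, G n x) atTop := lintegral_liminf_le hGm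
    _ ≤ liminf (fun _ : ℕ => rieszVarC φ a b f) atTop :=
        liminf_le_liminf (Eventually.of_forall hGint)
    _ = _ := liminf_const _

end RieszAux

/-- **Orlicz case, `K = ∞`** (Corollary 1.4(2)).  If `φ ∈ Φ_c` is independent of `x`,
`lim_{t→∞} φ(t)/t = ∞` and `V^φ_I(f) < ∞`, then `f` is absolutely continuous on `I`
and `V^φ_I(f) = ∫_I φ(|f'|) dx`. -/
theorem riesz_variation_orlicz_infinite_slope (a b : ℝ) (hab : a < b)
    (φ : ℝ → ℝ≥0∞) (hφ : IsPhiC φ)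
    (hK : Tendsto (fun t : ℝ => φ t / ENNReal.ofReal t) atTop (nhds ⊤))
    (f : ℝ → ℝ) (hfin : rieszVarC φ a b f ≠ ⊤) :
    AbsContOn f a b ∧ rieszVarC φ a b f = ∫⁻ x in Set.Icc a b, φ |deriv f x| := by
  have hac := RieszAux.absCont a b hab φ hK f hfin
  have hac' := RieszAux.toMathlib a b hab f hac
  exact ⟨hac, le_antisymm (RieszAux.upper a b hab φ hφ f hac')
    (RieszAux.lower a b hab φ hφ f hac')⟩
end

section
/- Let I=[a,b]⊂ℝ be a closed nondegenerate interval and let φ∈Φ_c(I) satisfy (VA1) and (aDec)_q for some q<∞. If f is absolutely continuous on I, then V̄^φ_I(f) = ∫_I φ(x,|f'(x)|) dx. -/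
open MeasureTheory Filter Set
open scoped ENNReal

open Topology

/-- Real-valued convex functions on `[0,∞)` with doubling constant `C`. -/
structure GoodFn (C : ℝ) (ψ : ℝ → ℝ) : Prop where
  convex : ConvexOn ℝ (Ici 0) ψ
  zero : ψ 0 = 0
  nonneg : ∀ t, 0 ≤ ψ t
  mono : MonotoneOn ψ (Ici 0)
  cont : ContinuousOn ψ (Ici 0)
  dbl : ∀ t, 0 ≤ t → ψ (2 * t) ≤ C * ψ t

theorem GoodFn.subgrad {C : ℝ} {ψ : ℝ → ℝ} (h : GoodFn C ψ) {τ : ℝ} (hτ : 0 < τ) :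
    ∃ m : ℝ, ∀ u, 0 ≤ u → ψ τ + m * (u - τ) ≤ ψ u := by
  have hin : τ ∈ interior (Ici (0 : ℝ)) := by simpa using hτ
  refine ⟨derivWithin ψ (Ioi τ) τ, fun u hu => ?_⟩
  rcases lt_trichotomy u τ with hlt | heq | hgt
  · have h1 := h.convex.slope_le_leftDeriv_of_mem_interior (x := u) (y := τ) hu hin hlt
    have h2 := h.convex.leftDeriv_le_rightDeriv_of_mem_interior hin
    have h3 := h1.trans h2
    rw [slope_def_field, div_le_iff₀ (by linarith)] at h3
    linarith
  · subst heq; simp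
  · have h1 := h.convex.rightDeriv_le_slope_of_mem_interior (x := τ) (y := u) hin hu hgt
    rw [slope_def_field, le_div_iff₀ (by linarith)] at h1
    linarith

theorem GoodFn.scale {C : ℝ} {ψ : ℝ → ℝ} (h : GoodFn C ψ) {t w : ℝ} (ht : 0 ≤ t)
    (hw : 0 ≤ w) (hw1 : w ≤ 1) : ψ ((1 + w) * t) ≤ (1 + C * w) * ψ t := by
  have h1 := h.convex.2 (show t ∈ Ici 0 from ht) (show 2 * t ∈ Ici 0 from mul_nonneg zero_le_two ht)
    (show 0 ≤ 1 - w by linarith) hw (by ring)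
  simp only [smul_eq_mul] at h1
  have h2 := h.dbl t ht
  have h3 := h.nonneg t
  have : (1 - w) * t + w * (2 * t) = (1 + w) * t := by ring
  rw [this] at h1
  nlinarith [mul_le_mul_of_nonneg_left h2 hw, mul_nonneg hw h3]

theorem GoodFn.ray {C : ℝ} {ψ : ℝ → ℝ} (h : GoodFn C ψ) {s u : ℝ} (hs : 0 ≤ s)
    (hu : 0 < u) (hsu : s ≤ u) : u * ψ s ≤ s * ψ u := by
  have h1 := h.convex.2 (show (0 : ℝ) ∈ Ici 0 from self_mem_Ici) (show u ∈ Ici 0 from hu.le)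
    (show 0 ≤ 1 - s / u by rw [sub_nonneg, div_le_one hu]; exact hsu)
    (show 0 ≤ s / u by positivity) (by ring)
  simp only [smul_eq_mul, h.zero] at h1
  have : (1 - s / u) * 0 + s / u * u = s := by field_simp; ring
  rw [this] at h1
  have h2 := mul_le_mul_of_nonneg_left h1 hu.le
  have : u * ((1 - s / u) * 0 + s / u * ψ u) = s * ψ u := by field_simp; ring
  linarith

theorem GoodFn.ivt {C : ℝ} {ψ : ℝ → ℝ} (h : GoodFn C ψ) {u R : ℝ} (hu : 0 ≤ u)
    (hR : 0 < R) (hR2 : R ≤ ψ u) : ∃ s, 0 < s ∧ s ≤ u ∧ ψ s = R := by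
  have := intermediate_value_Icc hu (h.cont.mono (Icc_subset_Ici_self))
  rw [h.zero] at this
  obtain ⟨s, hs, hs2⟩ := this ⟨hR.le, hR2⟩
  refine ⟨s, lt_of_le_of_ne hs.1 ?_, hs.2, hs2⟩
  rintro rfl
  rw [h.zero] at hs2
  linarith

theorem key_pointwise {C : ℝ} {ψx ψy : ℝ → ℝ} (hx : GoodFn C ψx) (hy : GoodFn C ψy)
    {w R A' τ m : ℝ} (hC : 0 ≤ C) (hw : 0 ≤ w) (hR : 0 < R) (hτ : 0 < τ)
    (hA : ψx τ ≤ A')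
    (hva : ∀ t, 0 ≤ t → ψy t ≤ R → ψx (t / (1 + w)) ≤ ψy t + w)
    (hm : ∀ u, 0 ≤ u → ψx τ + m * (u - τ) ≤ ψx u) {u : ℝ} (hu : 0 ≤ u) :
    ψx τ + m * (u / (1 + w) - τ) ≤ (1 + (w + C * A') / R) * ψy u + w := by
  have hw1 : 0 < 1 + w := by linarith
  have h0 := hm 0 le_rfl
  have h2 := hm (2 * τ) (by linarith)
  have hd := hx.dbl τ hτ.le
  rw [hx.zero] at h0
  have hn := hx.nonneg τ
  have hny := hy.nonneg u
  have hA0 : 0 ≤ A' := hn.trans hA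
  have hCA : C * ψx τ ≤ C * A' := mul_le_mul_of_nonneg_left hA hC
  have hCA0 : 0 ≤ C * A' := mul_nonneg hC hA0
  have he : 0 ≤ (w + C * A') / R := by positivity
  by_cases hc : ψy u ≤ R
  · have h3 := hm (u / (1 + w)) (by positivity)
    have h4 := hva u hu hc
    nlinarith [mul_nonneg he hny]
  · push Not at hc
    obtain ⟨s, hs0, hsu, hs⟩ := hy.ivt hu hR hc.le
    have hu0 : 0 < u := hs0.trans_le hsu
    have h3 := hm (s / (1 + w)) (by positivity)
    have h4 := hva s hs0.le hs.le
    have h5 := hy.ray hs0.le hu0 hsu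
    rw [hs] at h4 h5
    have h6 : m * (s / (1 + w)) ≤ R + w + C * A' := by linarith
    have h7 : m * (u / (1 + w)) ≤ (1 + (w + C * A') / R) * ψy u := by
      have e1 : m * (u / (1 + w)) = (u / s) * (m * (s / (1 + w))) := by field_simp
      have e2 : R + w + C * A' = (1 + (w + C * A') / R) * R := by field_simp; ring
      rw [e1]
      calc (u / s) * (m * (s / (1 + w))) ≤ (u / s) * (R + w + C * A') :=
            mul_le_mul_of_nonneg_left h6 (by positivity)
        _ = (1 + (w + C * A') / R) * (u * R / s) := by rw [e2]; ring
        _ ≤ _ := by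
            apply mul_le_mul_of_nonneg_left _ (by linarith)
            rw [div_le_iff₀ hs0]; linarith
    linarith

theorem key_interval1 {C : ℝ} {ψ : ℝ → ℝ → ℝ} {c d x : ℝ} (hcd : c < d) (hx : x ∈ Icc c d)
    (hψ : ∀ y ∈ Icc c d, GoodFn C (ψ y)) {w R A' e τ : ℝ} (hC : 0 ≤ C) (hw : 0 ≤ w)
    (hR : 0 < R) (hτ : 0 < τ) (hA : ψ x τ ≤ A')
    (hva : ∀ y ∈ Icc c d, ∀ t, 0 ≤ t → ψ y t ≤ R → ψ x (t / (1 + w)) ≤ ψ y t + w)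
    (he : (w + C * A') / R ≤ e) {g : ℝ → ℝ} (hg : ∀ y, 0 ≤ g y)
    (hgi : IntervalIntegrable g volume c d)
    (hGi : IntervalIntegrable (fun y => ψ y (g y)) volume c d)
    (hav : τ * (1 + w) * (d - c) ≤ ∫ y in c..d, g y) :
    ψ x τ * (d - c) ≤ (1 + e) * (∫ y in c..d, ψ y (g y)) + w * (d - c) := by
  have hw1 : 0 < 1 + w := by linarith
  obtain ⟨m, hm⟩ := (hψ x hx).subgrad hτ
  have h0 := hm 0 le_rfl
  rw [(hψ x hx).zero] at h0
  have hm0 : 0 ≤ m := by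
    by_contra hneg
    push Not at hneg
    nlinarith [(hψ x hx).nonneg τ, mul_neg_of_neg_of_pos hneg hτ]
  have hmono : ∫ y in c..d, (ψ x τ - m * τ + m / (1 + w) * g y) ≤
      ∫ y in c..d, ((1 + e) * ψ y (g y) + w) := by
    apply intervalIntegral.integral_mono_on hcd.le
    · exact (intervalIntegrable_const).add (hgi.const_mul _)
    · exact (hGi.const_mul _).add intervalIntegrable_const
    · intro y hy
      have h1 := key_pointwise (hψ x hx) (hψ y hy) hC hw hR hτ hA (hva y hy) hm (hg y)
      have h2 := (hψ y hy).nonneg (g y)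
      have h3 := mul_le_mul_of_nonneg_right he h2
      have : m * (g y / (1 + w) - τ) = m / (1 + w) * g y - m * τ := by ring
      rw [this] at h1
      linarith
  rw [intervalIntegral.integral_add intervalIntegrable_const (hgi.const_mul _),
    intervalIntegral.integral_add (hGi.const_mul _) intervalIntegrable_const,
    intervalIntegral.integral_const_mul, intervalIntegral.integral_const_mul,
    intervalIntegral.integral_const, intervalIntegral.integral_const] at hmono
  simp only [smul_eq_mul] at hmono
  have h3 := mul_le_mul_of_nonneg_left hav (div_nonneg hm0 hw1.le)
  have h4 : m / (1 + w) * (τ * (1 + w) * (d - c)) = m * τ * (d - c) := by field_simp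
  linarith

theorem key_interval2 {C : ℝ} {ψ : ℝ → ℝ → ℝ} {c d x : ℝ} (hcd : c < d) (hx : x ∈ Icc c d)
    (hψ : ∀ y ∈ Icc c d, GoodFn C (ψ y)) {w R A' e t : ℝ} (hC : 0 ≤ C) (hw : 0 ≤ w)
    (hw1 : w ≤ 1) (hR : 0 < R) (ht : 0 ≤ t) (hA0 : 0 < A')
    (hva : ∀ y ∈ Icc c d, ∀ t, 0 ≤ t → ψ y t ≤ R → ψ x (t / (1 + w)) ≤ ψ y t + w)
    (he : (w + C * A') / R ≤ e) {g : ℝ → ℝ} (hg : ∀ y, 0 ≤ g y)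
    (hgi : IntervalIntegrable g volume c d)
    (hGi : IntervalIntegrable (fun y => ψ y (g y)) volume c d)
    (hav : t * (d - c) ≤ ∫ y in c..d, g y)
    (hA : (1 + e) * (∫ y in c..d, ψ y (g y)) + w * (d - c) < A' * (d - c)) :
    ψ x t * (d - c) ≤
      (1 + C * w) * ((1 + e) * (∫ y in c..d, ψ y (g y)) + w * (d - c)) := by
  have hp : 0 < 1 + w := by linarith
  have hdc : 0 < d - c := by linarith
  have hGn : 0 ≤ ∫ y in c..d, ψ y (g y) :=
    intervalIntegral.integral_nonneg hcd.le fun y hy => (hψ y hy).nonneg _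
  have he0 : 0 ≤ e := le_trans (by positivity) he
  rcases ht.eq_or_lt with rfl | ht0
  · rw [(hψ x hx).zero]; rw [zero_mul]; positivity
  have hs := (hψ x hx).scale (t := t / (1 + w)) (by positivity) hw hw1
  rw [mul_div_cancel₀ _ hp.ne'] at hs
  have hkey : ψ x (t / (1 + w)) * (d - c) ≤
      (1 + e) * (∫ y in c..d, ψ y (g y)) + w * (d - c) := by
    by_cases hle : ψ x (t / (1 + w)) ≤ A'
    · apply key_interval1 hcd hx hψ hC hw hR (by positivity) hle hva he hg hgi hGi
      rw [div_mul_cancel₀ _ hp.ne']; exact hav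
    · exfalso
      push Not at hle
      obtain ⟨s, hs0, hsu, hsA⟩ := (hψ x hx).ivt (by positivity) hA0 hle.le
      have := key_interval1 hcd hx hψ hC hw hR hs0 hsA.le hva he hg hgi hGi (by
        refine le_trans ?_ hav
        apply mul_le_mul_of_nonneg_right _ hdc.le
        rwa [← le_div_iff₀ hp])
      rw [hsA] at this
      linarith
  have hcw : 0 ≤ 1 + C * w := by positivity
  calc ψ x t * (d - c) ≤ (1 + C * w) * ψ x (t / (1 + w)) * (d - c) :=
        mul_le_mul_of_nonneg_right hs hdc.le
    _ = (1 + C * w) * (ψ x (t / (1 + w)) * (d - c)) := by ring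
    _ ≤ _ := mul_le_mul_of_nonneg_left hkey hcw

theorem good_of {a b q : ℝ} {φ : ℝ → ℝ → ℝ≥0∞} (hφ : IsPhiCx φ (Set.Icc a b))
    (hq : ADecQ φ (Set.Icc a b) q) :
    ∃ C : ℝ, 0 ≤ C ∧ ∀ x ∈ Icc a b, (∀ t, 0 ≤ t → φ x t ≠ ⊤) ∧
      GoodFn C (fun t => (φ x t).toReal) := by
  obtain ⟨L, hL, hdec⟩ := hq
  refine ⟨L * 2 ^ q, by positivity, fun x hx => ?_⟩
  have hfin : ∀ t, 0 ≤ t → φ x t ≠ ⊤ := by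
    intro t ht
    rcases ht.eq_or_lt with rfl | ht0
    · rw [hφ.toIsPhiW.map_zero x hx]; simp
    have h1 : ∀ᶠ s in 𝓝[>] (0 : ℝ), φ x s < 1 :=
      (hφ.toIsPhiW.tendsto_zero x hx).eventually (gt_mem_nhds (by simp))
    obtain ⟨s, hs1, hs2⟩ := (h1.and (Ioo_mem_nhdsGT ht0)).exists
    have h2 := hdec x hx s t hs2.1 hs2.2.le
    intro htop
    rw [htop, ENNReal.top_div_of_ne_top ENNReal.ofReal_ne_top, top_le_iff] at h2
    refine ENNReal.mul_ne_top ENNReal.ofReal_ne_top (ENNReal.div_ne_top ?_ ?_) h2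
    · exact (hs1.trans ENNReal.one_lt_top).ne
    · have := Real.rpow_pos_of_pos hs2.1 q
      simpa using this
  refine ⟨hfin, ?_⟩
  have hconv : ConvexOn ℝ (Ici 0) (fun t => (φ x t).toReal) := by
    refine ⟨convex_Ici 0, ?_⟩
    intro s hs t ht α β hα hβ hαβ
    have hβ' : β = 1 - α := by linarith
    have h1 := hφ.convex x hx s t α hs ht hα (by linarith)
    rw [← hβ'] at h1
    have h2 := ENNReal.toReal_mono (ENNReal.add_ne_top.2
      ⟨ENNReal.mul_ne_top ENNReal.ofReal_ne_top (hfin s hs),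
       ENNReal.mul_ne_top ENNReal.ofReal_ne_top (hfin t ht)⟩) h1
    rw [ENNReal.toReal_add (ENNReal.mul_ne_top ENNReal.ofReal_ne_top (hfin s hs))
      (ENNReal.mul_ne_top ENNReal.ofReal_ne_top (hfin t ht)), ENNReal.toReal_mul,
      ENNReal.toReal_mul, ENNReal.toReal_ofReal hα, ENNReal.toReal_ofReal hβ] at h2
    simpa using h2
  have h0 : (φ x 0).toReal = 0 := by rw [hφ.toIsPhiW.map_zero x hx]; simp
  refine ⟨hconv, h0, fun t => ENNReal.toReal_nonneg, ?_, ?_, ?_⟩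
  · intro s hs t ht hst
    exact ENNReal.toReal_mono (hfin t ht) (hφ.toIsPhiW.mono x hx hs ht hst)
  · apply hconv.continuousOn_Ici
    rw [← continuousWithinAt_Ioi_iff_Ici]
    change Tendsto _ _ (𝓝 (φ x 0).toReal)
    rw [h0]
    have := (ENNReal.tendsto_toReal ENNReal.zero_ne_top).comp (hφ.toIsPhiW.tendsto_zero x hx)
    simpa [Function.comp_def] using this
  · intro t ht
    rcases ht.eq_or_lt with rfl | ht0
    · simp [h0]
    have h1 := hdec x hx t (2 * t) ht0 (by linarith)
    have hp1 := Real.rpow_pos_of_pos ht0 q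
    have hp2 := Real.rpow_pos_of_pos (show (0 : ℝ) < 2 by norm_num) q
    have h2 := ENNReal.toReal_mono (ENNReal.mul_ne_top ENNReal.ofReal_ne_top
      (ENNReal.div_ne_top (hfin t ht) (by simpa using hp1))) h1
    rw [ENNReal.toReal_mul, ENNReal.toReal_div, ENNReal.toReal_div,
      ENNReal.toReal_ofReal (by positivity), ENNReal.toReal_ofReal (by positivity),
      ENNReal.toReal_ofReal (by positivity), Real.mul_rpow (by norm_num) ht,
      div_le_iff₀ (by positivity)] at h2
    refine h2.trans (le_of_eq ?_)
    field_simp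

theorem ac_of {a b : ℝ} {f : ℝ → ℝ} (hab : a < b) (hf : AbsContOn f a b) :
    AbsolutelyContinuousOnInterval f a b := by
  rw [absolutelyContinuousOnInterval_iff]
  intro ε hε
  obtain ⟨δ, hδ, h⟩ := hf ε hε
  refine ⟨δ, hδ, ?_⟩
  rintro ⟨m, E⟩ ⟨hE1, hE2⟩ hE3
  simp only [uIcc_of_le hab.le, Finset.mem_range] at hE1 hE3
  -- keep only the nondegenerate pairs by collapsing degenerate ones
  have hs : ∀ x y : ℝ, |f (max x y) - f (min x y)| = dist (f x) (f y) := by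
    intro x y
    rcases le_total x y with hxy | hxy
    · rw [max_eq_right hxy, min_eq_left hxy, Real.dist_eq, abs_sub_comm]
    · rw [max_eq_left hxy, min_eq_right hxy, Real.dist_eq]
  have hd : ∀ x y : ℝ, max x y - min x y = dist x y := by
    intro x y
    rw [Real.dist_eq, max_sub_min_eq_abs, abs_sub_comm]
  have hmem : ∀ i < m, a ≤ min (E i).1 (E i).2 ∧ max (E i).1 (E i).2 ≤ b := by
    intro i hi
    have h1 := hE1 i hi
    exact ⟨le_min h1.1.1 h1.2.1, max_le h1.1.2 h1.2.2⟩
  let D : ℕ → Prop := fun i => (E i).1 = (E i).2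
  have := h m (fun i => open Classical in if D i then a else min (E i).1 (E i).2)
    (fun i => open Classical in if D i then a else max (E i).1 (E i).2) ?_ ?_ ?_
  · refine lt_of_eq_of_lt (Finset.sum_congr rfl fun i hi => ?_) this
    by_cases hD : D i
    · have : (E i).1 = (E i).2 := hD
      simp [hD, this]
    · simp [hD, hs]
  · intro i hi
    by_cases hD : D i
    · simp [hD, hab.le]
    · simp only [hD, if_false]
      exact ⟨(hmem i hi).1, min_le_max, (hmem i hi).2⟩
  · intro i j hij hj
    have hi := hij.trans hj
    by_cases hDi : D i
    · left
      by_cases hDj : D j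
      · simp [hDi, hDj]
      · simp only [hDi, hDj, if_true, if_false]; exact (hmem j hj).1
    · by_cases hDj : D j
      · right
        simp only [hDi, hDj, if_true, if_false]; exact (hmem i hi).1
      · simp only [hDi, hDj, if_false]
        have hdis := hE2 (by simpa using hi) (by simpa using hj) hij.ne
        simp only [Function.onFun, uIoc, Set.Ioc_disjoint_Ioc] at hdis
        have hi' : min (E i).1 (E i).2 < max (E i).1 (E i).2 := min_lt_max.2 hDi
        have hj' : min (E j).1 (E j).2 < max (E j).1 (E j).2 := min_lt_max.2 hDj
        rcases min_le_iff.1 hdis with h1 | h1 <;> rcases le_max_iff.1 h1 with h2 | h2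
        · exact absurd h2 (not_le.2 hi')
        · exact Or.inl h2
        · exact Or.inr h2
        · exact absurd h2 (not_le.2 hj')
  · refine lt_of_eq_of_lt (Finset.sum_congr rfl fun i hi => ?_) hE3
    by_cases hD : D i
    · have : (E i).1 = (E i).2 := hD
      simp [hD, this]
    · simp [hD, hd]

theorem quot_tendsto {f : ℝ → ℝ} {f' x : ℝ} (h : HasDerivAt f f' x) {u v : ℕ → ℝ}
    (hu : ∀ n, u n ≤ x) (hv : ∀ n, x ≤ v n) (huv : ∀ n, u n < v n)
    (hut : Tendsto u atTop (𝓝 x)) (hvt : Tendsto v atTop (𝓝 x)) :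
    Tendsto (fun n => (f (v n) - f (u n)) / (v n - u n)) atTop (𝓝 f') := by
  rw [Metric.tendsto_atTop']
  intro ε hε
  have h1 := h.isLittleO.def (half_pos hε)
  have h2 := (hut.eventually h1).and (hvt.eventually h1)
  obtain ⟨N, hN⟩ := eventually_atTop.1 h2
  refine ⟨N, fun n hn => ?_⟩
  obtain ⟨h3, h4⟩ := hN n hn.le
  simp only [Real.norm_eq_abs, smul_eq_mul] at h3 h4
  have hp : 0 < v n - u n := by linarith [huv n]
  rw [abs_of_nonpos (by linarith [hu n] : u n - x ≤ 0)] at h3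
  rw [abs_of_nonneg (by linarith [hv n] : 0 ≤ v n - x)] at h4
  rw [abs_le] at h3 h4
  rw [Real.dist_eq]
  have e : (f (v n) - f (u n)) / (v n - u n) - f' =
      (f (v n) - f (u n) - f' * (v n - u n)) / (v n - u n) := by field_simp
  rw [e, abs_div, abs_of_pos hp, div_lt_iff₀ hp]
  have : |f (v n) - f (u n) - f' * (v n - u n)| ≤ ε / 2 * (v n - u n) := by
    rw [abs_le]; constructor <;> nlinarith
  nlinarith

theorem lintegral_Ico_sum (F : ℝ → ℝ≥0∞) (x : ℕ → ℝ) (n : ℕ)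
    (hx : ∀ i < n, x i ≤ x (i + 1)) : x 0 ≤ x n ∧
    ∫⁻ y in Ico (x 0) (x n), F y = ∑ k ∈ Finset.range n, ∫⁻ y in Ico (x k) (x (k + 1)), F y := by
  induction n with
  | zero => simp
  | succ n ih =>
    obtain ⟨h1, h2⟩ := ih fun i hi => hx i (hi.trans n.lt_succ_self)
    have h3 := hx n n.lt_succ_self
    refine ⟨h1.trans h3, ?_⟩
    rw [Finset.sum_range_succ, ← h2, ← Ico_union_Ico_eq_Ico h1 h3,
      lintegral_union measurableSet_Ico (Ico_disjoint_Ico_same)]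

/-- The uniform partition. -/
noncomputable def unifPart (a b : ℝ) (hab : a < b) (N : ℕ) : IntervalPartition a b where
  n := N + 1
  npos := N.succ_pos
  x := fun k => a + k * ((b - a) / (N + 1))
  left := by simp
  right := by push_cast; field_simp; ring
  strict := by
    intro i _
    have : 0 < (b - a) / ((N : ℝ) + 1) := div_pos (by linarith) (by positivity)
    push_cast
    linarith

theorem lower_bound {a b : ℝ} (hab : a < b)
    {φ : ℝ → ℝ → ℝ≥0∞} (hφ : IsPhiCx φ (Set.Icc a b))
    {f : ℝ → ℝ} (hf : AbsolutelyContinuousOnInterval f a b) :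
    ∫⁻ x in Set.Icc a b, φ x |deriv f x| ≤ rieszVarUpper φ a b f := by
  rw [← restrict_Ico_eq_restrict_Icc]
  let h : ℕ → ℝ := fun N => (b - a) / ((N : ℝ) + 1)
  have hpos : ∀ N, 0 < h N := fun N => div_pos (by linarith) (by positivity)
  have hlim : Tendsto h atTop (𝓝 0) := by
    have := (tendsto_one_div_add_atTop_nhds_zero_nat (𝕜 := ℝ)).const_mul (b - a)
    simpa [h, div_eq_mul_inv] using this
  let X : ℕ → ℕ → ℝ := fun N k => a + k * h N
  have hX : ∀ N k, X N (k + 1) - X N k = h N := by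
    intro N k; simp only [X]; push_cast; ring
  let g : ℕ → ℕ → ℝ := fun N k => (f (X N (k + 1)) - f (X N k)) / (X N (k + 1) - X N k)
  let κ : ℕ → ℝ → ℕ := fun N x => ⌊(x - a) / h N⌋₊
  have hκm : ∀ N, Measurable (κ N) := by
    intro N
    exact Nat.measurable_floor.comp ((measurable_id.sub_const a).div_const _)
  have hgm : ∀ N, Measurable fun x => g N (κ N x) := by
    intro N
    exact (measurable_from_nat (f := g N)).comp (hκm N)
  have hκ1 : ∀ N x, a ≤ x → X N (κ N x) ≤ x ∧ x < X N (κ N x + 1) := by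
    intro N x hx
    have h1 : 0 ≤ (x - a) / h N := div_nonneg (by linarith) (hpos N).le
    have h2 := Nat.floor_le h1
    have h3 := Nat.lt_floor_add_one ((x - a) / h N)
    rw [le_div_iff₀ (hpos N)] at h2
    rw [div_lt_iff₀ (hpos N)] at h3
    simp only [X, κ]
    push_cast
    constructor <;> linarith
  have hκ2 : ∀ N x k, x ∈ Ico (X N k) (X N (k + 1)) → κ N x = k := by
    intro N x k hx
    simp only [X, mem_Ico] at hx
    simp only [κ]
    have hp := hpos N
    push_cast at hx
    have hk : (0 : ℝ) ≤ k * h N := by positivity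
    rw [Nat.floor_eq_iff (div_nonneg (by linarith) hp.le), le_div_iff₀ hp, div_lt_iff₀ hp]
    constructor <;> linarith
  have hae : ∀ᵐ x ∂(volume.restrict (Ico a b)),
      φ x |deriv f x| ≤ liminf (fun N => φ x |g N (κ N x)|) atTop := by
    rw [ae_restrict_iff' measurableSet_Ico]
    filter_upwards [hf.ae_differentiableAt] with x hx hxI
    have hxI' : x ∈ Icc a b := Ico_subset_Icc_self hxI
    have hd := (hx (by rwa [uIcc_of_le hab.le])).hasDerivAt
    have hlu : Tendsto (fun N => X N (κ N x)) atTop (𝓝 x) := by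
      apply tendsto_of_tendsto_of_tendsto_of_le_of_le (g := fun N => x - h N) (h := fun _ => x)
      · simpa using hlim.const_sub x
      · exact tendsto_const_nhds
      · intro N
        have := hκ1 N x hxI.1
        have := hX N (κ N x)
        simp only; linarith
      · intro N; exact (hκ1 N x hxI.1).1
    have hlv : Tendsto (fun N => X N (κ N x + 1)) atTop (𝓝 x) := by
      apply tendsto_of_tendsto_of_tendsto_of_le_of_le (g := fun _ => x) (h := fun N => x + h N)
      · exact tendsto_const_nhds
      · simpa using hlim.const_add x
      · intro N; exact (hκ1 N x hxI.1).2.le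
      · intro N
        have := hκ1 N x hxI.1
        have := hX N (κ N x)
        simp only; linarith
    have hq := quot_tendsto hd (fun N => (hκ1 N x hxI.1).1) (fun N => (hκ1 N x hxI.1).2.le)
      (fun N => (hκ1 N x hxI.1).1.trans_lt (hκ1 N x hxI.1).2) hlu hlv
    have hq' : Tendsto (fun N => |g N (κ N x)|) atTop (𝓝 |deriv f x|) := hq.abs
    rcases (abs_nonneg (deriv f x)).eq_or_lt with h0 | h0
    · rw [← h0, hφ.toIsPhiW.map_zero x hxI']; exact bot_le
    refine le_of_forall_lt fun c hc => ?_
    obtain ⟨c', hcc', hc'⟩ := exists_between hc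
    refine hcc'.trans_le ?_
    have h1 := (hφ.leftCont x hxI' _ h0).eventually (lt_mem_nhds hc')
    obtain ⟨s, hs1, hs2⟩ := (h1.and (Ioo_mem_nhdsLT h0)).exists
    refine le_liminf_of_le (by isBoundedDefault) ?_
    filter_upwards [hq'.eventually (lt_mem_nhds hs2.2)] with N hN
    exact hs1.le.trans (hφ.toIsPhiW.mono x hxI' hs2.1.le (mem_Ici.2 (abs_nonneg _)) hN.le)
  have hsum : ∀ N, ∫⁻ x in Ico a b, φ x |g N (κ N x)| ≤ vSum φ f (unifPart a b hab N) := by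
    intro N
    have h1 := (lintegral_Ico_sum (fun x => φ x |g N (κ N x)|) (unifPart a b hab N).x
      (unifPart a b hab N).n (fun i hi => ((unifPart a b hab N).strict i hi).le)).2
    rw [(unifPart a b hab N).left, (unifPart a b hab N).right] at h1
    rw [h1, vSum]
    refine Finset.sum_le_sum fun k hk => ?_
    have hxx : ∀ k, (unifPart a b hab N).x k = X N k := fun k => rfl
    rw [hxx, hxx]
    rw [← Real.volume_Ico, ← setLIntegral_const]
    refine setLIntegral_mono' measurableSet_Ico fun x hx => ?_
    rw [hκ2 N x k hx]
    simp only [g]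
    have hXp : 0 < X N (k + 1) - X N k := by rw [hX]; exact hpos N
    rw [abs_div, abs_of_pos hXp]
    exact le_iSup₂ (f := fun x (_ : x ∈ Icc (X N k) (X N (k + 1))) =>
      φ x (|f (X N (k + 1)) - f (X N k)| / (X N (k + 1) - X N k))) x (Ico_subset_Icc_self hx)
  refine le_iInf₂ fun δ hδ => ?_
  calc ∫⁻ x in Ico a b, φ x |deriv f x|
      ≤ ∫⁻ x in Ico a b, liminf (fun N => φ x |g N (κ N x)|) atTop := lintegral_mono_ae hae
    _ ≤ liminf (fun N => ∫⁻ x in Ico a b, φ x |g N (κ N x)|) atTop :=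
        lintegral_liminf_le fun N => hφ.toIsPhiW.meas _ (hgm N)
    _ ≤ liminf (fun _ : ℕ => ⨆ (P : IntervalPartition a b) (_ : P.mesh < δ), vSum φ f P)
          atTop := by
        refine liminf_le_liminf ?_
        filter_upwards [hlim.eventually (gt_mem_nhds hδ)] with N hN
        refine (hsum N).trans ?_
        refine le_iSup₂ (f := fun (P : IntervalPartition a b) (_ : P.mesh < δ) => vSum φ f P)
          (unifPart a b hab N) ?_
        rw [IntervalPartition.mesh, Finset.sup'_lt_iff]
        intro k _
        exact (hX N k).trans_lt hN
    _ = _ := liminf_const _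

theorem IntervalPartition.mono_aux {a b : ℝ} (P : IntervalPartition a b) :
    ∀ j ≤ P.n, ∀ i ≤ j, P.x i ≤ P.x j := by
  intro j
  induction j with
  | zero => intro _ i hi; rw [Nat.le_zero.1 hi]
  | succ j ih =>
    intro hj i hi
    rcases Nat.lt_or_ge i (j + 1) with h | h
    · exact (ih (by omega) i (by omega)).trans (P.strict j (by omega)).le
    · rw [le_antisymm hi h]

theorem upper_bound {a b : ℝ} (hab : a < b)
    {φ : ℝ → ℝ → ℝ≥0∞} (hφ : IsPhiCx φ (Set.Icc a b)) (hva1 : VA1 φ (Set.Icc a b))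
    {q : ℝ} (hq : ADecQ φ (Set.Icc a b) q)
    {f : ℝ → ℝ} (hf : AbsolutelyContinuousOnInterval f a b) :
    rieszVarUpper φ a b f ≤ ∫⁻ x in Set.Icc a b, φ x |deriv f x| := by
  by_cases htop : ∫⁻ x in Set.Icc a b, φ x |deriv f x| = ⊤
  · rw [htop]; exact le_top
  obtain ⟨C, hC, hgood⟩ := good_of hφ hq
  let ψ : ℝ → ℝ → ℝ := fun x t => (φ x t).toReal
  let g : ℝ → ℝ := fun x => |deriv f x|
  have hgm : Measurable fun x => φ x |deriv f x| := hφ.toIsPhiW.meas _ (measurable_deriv f)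
  have hg0 : ∀ y, 0 ≤ g y := fun y => abs_nonneg _
  have hgi : IntervalIntegrable g volume a b := hf.intervalIntegrable_deriv.abs
  have hGi' : Integrable (fun y => ψ y (g y)) (volume.restrict (Icc a b)) :=
    integrable_toReal_of_lintegral_ne_top hgm.aemeasurable htop
  have hGi : IntervalIntegrable (fun y => ψ y (g y)) volume a b := by
    rw [intervalIntegrable_iff_integrableOn_Icc_of_le hab.le]; exact hGi'
  set S : ℝ := ∫ y in a..b, ψ y (g y) with hS
  have hSeq : ∫⁻ x in Set.Icc a b, φ x |deriv f x| = ENNReal.ofReal S := by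
    rw [hS, intervalIntegral.integral_of_le hab.le, ← integral_Icc_eq_integral_Ioc,
      integral_toReal hgm.aemeasurable, ENNReal.ofReal_toReal htop]
    exact ae_lt_top hgm htop
  have hS0 : 0 ≤ S := intervalIntegral.integral_nonneg hab.le fun y hy => ENNReal.toReal_nonneg
  rw [hSeq]
  -- choose the error parameter
  refine ENNReal.le_of_forall_pos_le_add fun η hη _ => ?_
  have hη' : (0 : ℝ) < η := hη
  have hcont : Tendsto (fun e : ℝ => (1 + C * e) * ((1 + e) * S + e * (b - a))) (𝓝[>] 0) (𝓝 S) := by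
    have h1 : Continuous fun e : ℝ => (1 + C * e) * ((1 + e) * S + e * (b - a)) := by fun_prop
    have h2 := h1.tendsto 0
    simp only [mul_zero, add_zero, zero_mul, one_mul] at h2
    exact h2.mono_left nhdsWithin_le_nhds
  obtain ⟨e, he1, he2⟩ := ((hcont.eventually (gt_mem_nhds (by linarith : S < S + η))).and
    (Ioo_mem_nhdsGT one_pos)).exists
  have he0 : 0 < e := he2.1
  set A : ℝ := 4 * S + 2 * (b - a) + 2 with hA
  have hba : 0 < b - a := by linarith
  have hApos : 0 < A := by positivity
  set K : ℝ := (2 * (b - a) + C * A) / e with hK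
  have hKpos : 0 < K := by positivity
  obtain ⟨ω, ⟨hω0, hωt⟩, hω⟩ := hva1 K hKpos
  have hωe : ∀ᶠ r in 𝓝[>] (0 : ℝ), ω r < e := hωt.eventually (gt_mem_nhds he0)
  obtain ⟨δ, hδ, hδ2⟩ := (mem_nhdsGT_iff_exists_Ioo_subset).1 hωe
  refine iInf₂_le_of_le δ hδ (iSup₂_le fun P hP => ?_)
  rw [IntervalPartition.mesh, Finset.sup'_lt_iff] at hP
  -- the bound on one interval
  have hone : ∀ k ∈ Finset.range P.n,
      phiSup φ (Icc (P.x k) (P.x (k + 1)))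
        (|f (P.x (k + 1)) - f (P.x k)| / (P.x (k + 1) - P.x k)) *
      ENNReal.ofReal (P.x (k + 1) - P.x k) ≤
      ENNReal.ofReal ((1 + C * e) * ((1 + e) * (∫ y in P.x k..P.x (k + 1), ψ y (g y)) +
        e * (P.x (k + 1) - P.x k))) := by
    intro k hk
    have hkn := Finset.mem_range.1 hk
    have hcd := P.strict k hkn
    have hac : a ≤ P.x k := P.left.symm.le.trans (P.mono_aux k hkn.le 0 (Nat.zero_le _))
    have hdb : P.x (k + 1) ≤ b := by
      have := P.mono_aux P.n le_rfl (k + 1) hkn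
      rwa [P.right] at this
    have hmesh := hP k hk
    generalize P.x k = c at *
    generalize P.x (k + 1) = d at *
    have hdc : 0 < d - c := by linarith
    have hsub : Icc c d ⊆ Icc a b := Icc_subset_Icc hac hdb
    have husub : uIcc c d ⊆ uIcc a b := by
      rw [uIcc_of_le hcd.le, uIcc_of_le hab.le]; exact hsub
    have hgi' := hgi.mono_set husub
    have hGi2 := hGi.mono_set husub
    have hw := hω0 (d - c)
    have hwe : ω (d - c) < e := hδ2 ⟨hdc, hmesh⟩
    set w := ω (d - c) with hwdef
    have hGS : (∫ y in c..d, ψ y (g y)) ≤ S := by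
      refine intervalIntegral.integral_mono_interval hac hcd.le hdb ?_ hGi
      exact Eventually.of_forall fun y => ENNReal.toReal_nonneg
    have hG0 : 0 ≤ ∫ y in c..d, ψ y (g y) :=
      intervalIntegral.integral_nonneg hcd.le fun y hy => ENNReal.toReal_nonneg
    have hfd : |f d - f c| ≤ ∫ y in c..d, g y := by
      rw [← (hf.mono husub).integral_deriv_eq_sub]
      exact intervalIntegral.abs_integral_le_integral_abs hcd.le
    rw [← ENNReal.le_div_iff_mul_le (Or.inl (by simpa using hcd))
      (Or.inl ENNReal.ofReal_ne_top), ← ENNReal.ofReal_div_of_pos hdc]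
    refine iSup₂_le fun x hx => ?_
    have ht : 0 ≤ |f d - f c| / (d - c) := by positivity
    rw [← ENNReal.ofReal_toReal ((hgood x (hsub hx)).1 _ ht)]
    refine ENNReal.ofReal_le_ofReal ?_
    rw [le_div_iff₀ hdc]
    have hball : ∀ y ∈ Icc c d, y ∈ Metric.ball ((c + d) / 2) (d - c) ∩ Icc a b := by
      intro y hy
      refine ⟨?_, hsub hy⟩
      rw [Metric.mem_ball, Real.dist_eq, abs_lt]
      constructor <;> linarith [hy.1, hy.2]
    have hR : 0 < K / (2 * (d - c)) := by positivity
    have hva : ∀ y ∈ Icc c d, ∀ t, 0 ≤ t → ψ y t ≤ K / (2 * (d - c)) →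
        ψ x (t / (1 + w)) ≤ ψ y t + w := by
      intro y hy t ht hle
      have hfy := (hgood y (hsub hy)).1 t ht
      have h1 := hω _ _ hdc x (hball x hx) y (hball y hy) t ht
        ((ENNReal.le_ofReal_iff_toReal_le hfy hR.le).2 hle)
      have h2 := ENNReal.toReal_mono (ENNReal.add_ne_top.2 ⟨hfy, ENNReal.ofReal_ne_top⟩) h1
      rwa [ENNReal.toReal_add hfy ENNReal.ofReal_ne_top, ENNReal.toReal_ofReal hw] at h2
    have hee : (w + C * (A / (2 * (d - c)))) / (K / (2 * (d - c))) ≤ e := by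
      have e1 : (w + C * (A / (2 * (d - c)))) / (K / (2 * (d - c))) =
        (w * (2 * (d - c)) + C * A) / K := by field_simp
      rw [e1, div_le_iff₀ hKpos, hK, mul_div_cancel₀ _ he0.ne']
      nlinarith [he2.2]
    have hAA : A / (2 * (d - c)) * (d - c) = A / 2 := by field_simp
    have hfin := key_interval2 hcd hx (fun y hy => (hgood y (hsub hy)).2) hC hw
      (hwe.le.trans he2.2.le) hR ht (A' := A / (2 * (d - c))) (by positivity) hva hee hg0 hgi' hGi2
      (by rw [div_mul_cancel₀ _ hdc.ne']; exact hfd)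
      (by
        rw [hAA, hA]
        have h1 : (1 + e) * (∫ y in c..d, ψ y (g y)) ≤ 2 * S := by nlinarith [he2.2]
        have h2 : w * (d - c) ≤ b - a := by nlinarith [he2.2]
        change (1 + e) * (∫ y in c..d, ψ y (g y)) + w * (d - c) < _
        linarith)
    refine hfin.trans ?_
    change (1 + C * w) * ((1 + e) * (∫ y in c..d, ψ y (g y)) + w * (d - c)) ≤ _
    gcongr
  calc vSum φ f P ≤ ∑ k ∈ Finset.range P.n,
        ENNReal.ofReal ((1 + C * e) * ((1 + e) * (∫ y in P.x k..P.x (k + 1), ψ y (g y)) +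
        e * (P.x (k + 1) - P.x k))) := Finset.sum_le_sum hone
    _ = ENNReal.ofReal (∑ k ∈ Finset.range P.n,
        ((1 + C * e) * ((1 + e) * (∫ y in P.x k..P.x (k + 1), ψ y (g y)) +
        e * (P.x (k + 1) - P.x k)))) := by
        rw [ENNReal.ofReal_sum_of_nonneg]
        intro k hk
        have hcd := P.strict k (Finset.mem_range.1 hk)
        have : 0 ≤ ∫ y in P.x k..P.x (k + 1), ψ y (g y) :=
          intervalIntegral.integral_nonneg hcd.le fun y hy => ENNReal.toReal_nonneg
        have : 0 ≤ P.x (k + 1) - P.x k := by linarith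
        positivity
    _ = ENNReal.ofReal ((1 + C * e) * ((1 + e) * S + e * (b - a))) := by
        congr 1
        rw [← Finset.mul_sum, Finset.sum_add_distrib, ← Finset.mul_sum, ← Finset.mul_sum,
          Finset.sum_range_sub, intervalIntegral.sum_integral_adjacent_intervals, P.left, P.right]
        intro k hk
        refine hGi.mono_set ?_
        rw [uIcc_of_le (P.strict k hk).le, uIcc_of_le hab.le]
        refine Icc_subset_Icc ?_ ?_
        · exact P.left.symm.le.trans (P.mono_aux k hk.le 0 (Nat.zero_le _))
        · have := P.mono_aux P.n le_rfl (k + 1) hk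
          rwa [P.right] at this
    _ ≤ ENNReal.ofReal (S + η) := ENNReal.ofReal_le_ofReal he1.le
    _ = ENNReal.ofReal S + η := by
        rw [ENNReal.ofReal_add hS0 hη'.le, ENNReal.ofReal_coe_nnreal]

/-- Corollary 6.5.  If `φ ∈ Φ_c([a,b])` satisfies (VA1) and (aDec)_q and `f` is absolutely
continuous on `[a,b]`, then `V̄^φ_I(f) = ∫_I φ(x,|f'|) dx`. -/
theorem riesz_variation_of_absolutely_continuous (a b : ℝ) (hab : a < b)
    (φ : ℝ → ℝ → ℝ≥0∞) (hφ : IsPhiCx φ (Set.Icc a b)) (hva1 : VA1 φ (Set.Icc a b))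
    (q : ℝ) (hq : ADecQ φ (Set.Icc a b) q)
    (f : ℝ → ℝ) (hf : AbsContOn f a b) :
    rieszVarUpper φ a b f = ∫⁻ x in Set.Icc a b, φ x |deriv f x| := by
  have hac := ac_of hab hf
  exact le_antisymm (upper_bound hab hφ hva1 hq hac) (lower_bound hab hφ hac)
end

section
/- Let I=[a,b]⊂ℝ be a closed nondegenerate interval and let φ∈Φ_w(I) satisfy (A0) and (A1). If f is absolutely continuous on I and f'∈L^φ(I), then f∈RBV^φ(I) and there is a constant c>0, depending only on φ and |I|, with ‖f‖_{RBV^φ(I)} ≤ c ‖f'‖_{L^φ(I)}. -/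
open MeasureTheory Filter Set
open scoped ENNReal

theorem aux_ac {f : ℝ → ℝ} {a b : ℝ} (hab : a < b) (h : AbsContOn f a b) :
    AbsolutelyContinuousOnInterval f a b := by
  rw [absolutelyContinuousOnInterval_iff]
  intro ε hε
  obtain ⟨δ, hδ, H⟩ := h ε hε
  refine ⟨δ, hδ, ?_⟩
  rintro ⟨m, E⟩ ⟨hE1, hE2⟩ hlen
  simp only at hE1 hE2 hlen ⊢
  have hmem : ∀ i < m, a ≤ (E i).1 ∧ (E i).1 ≤ b ∧ a ≤ (E i).2 ∧ (E i).2 ≤ b := by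
    intro i hi
    have := hE1 i (Finset.mem_range.2 hi)
    rw [uIcc_of_le hab.le] at this
    exact ⟨this.1.1, this.1.2, this.2.1, this.2.2⟩
  have key := H m (fun i => if (E i).1 = (E i).2 then a else min (E i).1 (E i).2)
    (fun i => if (E i).1 = (E i).2 then a else max (E i).1 (E i).2) ?_ ?_ ?_
  · refine lt_of_eq_of_lt (Finset.sum_congr rfl fun i hi => ?_) key
    by_cases h1 : (E i).1 = (E i).2
    · simp [h1]
    · simp only [h1, if_false, Real.dist_eq]
      rcases le_total (E i).1 (E i).2 with h2 | h2
      · rw [max_eq_right h2, min_eq_left h2, abs_sub_comm]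
      · rw [max_eq_left h2, min_eq_right h2]
  · intro i hi
    obtain ⟨h1, h2, h3, h4⟩ := hmem i hi
    by_cases h1 : (E i).1 = (E i).2
    · simp [h1, hab.le]
    · simp only [h1, if_false]
      exact ⟨le_min ‹_› ‹_›, min_le_max, max_le ‹_› ‹_›⟩
  · intro i j hij hj
    obtain ⟨h1, h2, h3, h4⟩ := hmem i (hij.trans hj)
    obtain ⟨g1, g2, g3, g4⟩ := hmem j hj
    by_cases hi0 : (E i).1 = (E i).2
    · left
      simp only [hi0, if_true]
      split_ifs
      · exact le_rfl
      · exact le_min g1 g3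
    by_cases hj0 : (E j).1 = (E j).2
    · right
      simp only [hj0, if_true, hi0, if_false]
      exact le_min h1 h3
    simp only [hi0, hj0, if_false]
    have hd := hE2 (Finset.mem_coe.2 (Finset.mem_range.2 (hij.trans hj)))
      (Finset.mem_coe.2 (Finset.mem_range.2 hj)) hij.ne
    simp only [Function.onFun, uIoc] at hd
    rw [Set.Ioc_disjoint_Ioc] at hd
    have k1 : min (E i).1 (E i).2 < max (E i).1 (E i).2 := min_lt_max.2 hi0
    have k2 : min (E j).1 (E j).2 < max (E j).1 (E j).2 := min_lt_max.2 hj0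
    rcases min_le_iff.1 hd with h | h <;> rcases le_max_iff.1 h with h | h
    · exact absurd h (not_le.2 k1)
    · exact Or.inl h
    · exact Or.inr h
    · exact absurd h (not_le.2 k2)
  · refine lt_of_eq_of_lt (Finset.sum_congr rfl fun i hi => ?_) hlen
    by_cases h1 : (E i).1 = (E i).2
    · simp [h1]
    · simp only [h1, if_false, Real.dist_eq]
      exact max_sub_min_eq_abs' _ _

theorem aux_mul {p q : ℝ≥0∞} {L s t : ℝ} (hL : 1 ≤ L) (hs : 0 < s) (ht : 0 < t)
    (h : p / ENNReal.ofReal s ≤ ENNReal.ofReal L * (q / ENNReal.ofReal t)) :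
    p * ENNReal.ofReal t ≤ ENNReal.ofReal (L * s) * q := by
  have hs0 : ENNReal.ofReal s ≠ 0 := by simpa using hs
  have ht0 : ENNReal.ofReal t ≠ 0 := by simpa using ht
  have e1 : p = p / ENNReal.ofReal s * ENNReal.ofReal s :=
    (ENNReal.div_mul_cancel hs0 ENNReal.ofReal_ne_top).symm
  have e2 : q / ENNReal.ofReal t * ENNReal.ofReal t = q :=
    (ENNReal.div_mul_cancel ht0 ENNReal.ofReal_ne_top)
  calc p * ENNReal.ofReal t
      = (p / ENNReal.ofReal s) * ENNReal.ofReal s * ENNReal.ofReal t := by rw [← e1]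
    _ ≤ (ENNReal.ofReal L * (q / ENNReal.ofReal t)) * ENNReal.ofReal s * ENNReal.ofReal t := by
        gcongr
    _ = ENNReal.ofReal L * ENNReal.ofReal s * (q / ENNReal.ofReal t * ENNReal.ofReal t) := by
        ring
    _ = _ := by rw [e2, ENNReal.ofReal_mul (by linarith)]

theorem aux_scale {φ : ℝ → ℝ → ℝ≥0∞} {a b L : ℝ} (hL : 1 ≤ L)
    (h0 : ∀ x ∈ Icc a b, φ x 0 = 0)
    (h : ∀ x ∈ Icc a b, ∀ s t : ℝ, 0 < s → s ≤ t →
      φ x s / ENNReal.ofReal s ≤ ENNReal.ofReal L * (φ x t / ENNReal.ofReal t))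
    {x : ℝ} (hx : x ∈ Icc a b) {θ t : ℝ} (hθ : 0 < θ) (hθ1 : θ ≤ 1) (ht : 0 ≤ t) :
    φ x (θ * t) ≤ ENNReal.ofReal (L * θ) * φ x t := by
  rcases ht.eq_or_lt with rfl | ht
  · simp [h0 x hx]
  have hs : 0 < θ * t := by positivity
  have := aux_mul hL hs ht (h x hx (θ * t) t hs (by nlinarith))
  rw [← mul_assoc, ENNReal.ofReal_mul (by positivity), mul_right_comm] at this
  exact (ENNReal.mul_le_mul_iff_left (by simpa using ht) ENNReal.ofReal_ne_top).1 this

theorem aux_part_mono {a b : ℝ} (P : IntervalPartition a b) :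
    ∀ m ≤ P.n, ∀ k ≤ m, P.x k ≤ P.x m := by
  intro m
  induction m with
  | zero => intro _ k hk; simp [Nat.le_zero.1 hk]
  | succ m ih =>
    intro hm k hk
    rcases Nat.le_succ_iff.1 hk with h | h
    · exact (ih (by omega) k h).trans (P.strict m (by omega)).le
    · subst h; exact le_rfl

theorem aux_part_Icc {a b : ℝ} (P : IntervalPartition a b) {k : ℕ} (hk : k < P.n) :
    Icc (P.x k) (P.x (k + 1)) ⊆ Icc a b := by
  have h1 := aux_part_mono P k hk.le 0 (Nat.zero_le _)
  have h2 := aux_part_mono P P.n le_rfl (k + 1) hk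
  rw [P.left] at h1
  rw [P.right] at h2
  exact Icc_subset_Icc h1 h2

theorem aux_sum_lint {a b : ℝ} (P : IntervalPartition a b) (F : ℝ → ℝ≥0∞) :
    ∑ k ∈ Finset.range P.n, ∫⁻ x in Ioc (P.x k) (P.x (k + 1)), F x
      = ∫⁻ x in Ioc a b, F x := by
  have : ∀ m ≤ P.n, ∑ k ∈ Finset.range m, ∫⁻ x in Ioc (P.x k) (P.x (k + 1)), F x
      = ∫⁻ x in Ioc (P.x 0) (P.x m), F x := by
    intro m
    induction m with
    | zero => simp
    | succ m ih =>
      intro hm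
      rw [Finset.sum_range_succ, ih (by omega), ← lintegral_union measurableSet_Ioc,
        Ioc_union_Ioc_eq_Ioc (aux_part_mono P m (by omega) 0 (Nat.zero_le _))
          (P.strict m (by omega)).le]
      exact Ioc_disjoint_Ioc_of_le le_rfl
  rw [this P.n le_rfl, P.left, P.right]

theorem aux_sum_len {a b : ℝ} (P : IntervalPartition a b) :
    ∑ k ∈ Finset.range P.n, ENNReal.ofReal (P.x (k + 1) - P.x k) = ENNReal.ofReal (b - a) := by
  simpa using aux_sum_lint P (fun _ => 1)

/-- scaling of the Riesz variation -/
theorem aux_var_scale {φ : ℝ → ℝ → ℝ≥0∞} {a b L : ℝ} (hL : 1 ≤ L)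
    (h0 : ∀ x ∈ Icc a b, φ x 0 = 0)
    (h : ∀ x ∈ Icc a b, ∀ s t : ℝ, 0 < s → s ≤ t →
      φ x s / ENNReal.ofReal s ≤ ENNReal.ofReal L * (φ x t / ENNReal.ofReal t))
    (f : ℝ → ℝ) {θ : ℝ} (hθ : 0 < θ) (hθ1 : θ ≤ 1) :
    rieszVar φ a b (fun x => θ * f x) ≤ ENNReal.ofReal (L * θ) * rieszVar φ a b f := by
  refine iSup_le fun P => ?_
  refine le_trans ?_ (mul_le_mul_right (le_iSup (fun P => vSum φ f P) P) _)
  simp only [vSum]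
  rw [Finset.mul_sum]
  refine Finset.sum_le_sum fun k hk => ?_
  rw [← mul_assoc]
  gcongr
  have hk := Finset.mem_range.1 hk
  refine iSup₂_le fun x hx => ?_
  have e : |θ * f (P.x (k + 1)) - θ * f (P.x k)| / (P.x (k + 1) - P.x k)
      = θ * (|f (P.x (k + 1)) - f (P.x k)| / (P.x (k + 1) - P.x k)) := by
    rw [← mul_sub, abs_mul, abs_of_pos hθ, mul_div_assoc]
  rw [e]
  refine (aux_scale hL h0 h (aux_part_Icc P hk hx) hθ hθ1
    (div_nonneg (abs_nonneg _) (sub_pos.2 (P.strict k hk)).le)).trans ?_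
  gcongr
  exact le_iSup₂ (f := fun x _ => φ x (|f (P.x (k + 1)) - f (P.x k)| / (P.x (k + 1) - P.x k))) x hx

/-- weak Jensen inequality on one interval -/
theorem aux_jensen {φ : ℝ → ℝ → ℝ≥0∞} {u v L s lam : ℝ} (huv : u < v) (hL : 1 ≤ L)
    (h : ∀ x ∈ Icc u v, ∀ s t : ℝ, 0 < s → s ≤ t →
      φ x s / ENNReal.ofReal s ≤ ENNReal.ofReal L * (φ x t / ENNReal.ofReal t))
    {f : ℝ → ℝ} (hf : AbsolutelyContinuousOnInterval f u v) (hlam : 0 < lam)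
    (hs : 0 < s) (hsf : 2 * s * (v - u) * lam = |f v - f u|) :
    phiInf φ (Icc u v) s * ENNReal.ofReal (v - u) ≤
      ENNReal.ofReal L * ∫⁻ x in Ioc u v, φ x (|deriv f x| / lam) := by
  set q := phiInf φ (Icc u v) s with hq
  have hpt : ∀ x ∈ Ioc u v, q * ENNReal.ofReal (|deriv f x| / lam - s) ≤
      ENNReal.ofReal (L * s) * φ x (|deriv f x| / lam) := by
    intro x hx
    have hx' := Ioc_subset_Icc_self hx
    rcases le_total (|deriv f x| / lam) s with hle | hle
    · rw [ENNReal.ofReal_of_nonpos (by linarith)]; simp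
    · refine le_trans ?_ (aux_mul hL hs (hs.trans_le hle) (h x hx' s _ hs hle))
      gcongr
      · exact iInf₂_le x hx'
      · linarith
  have hint : ENNReal.ofReal (s * (v - u)) ≤
      ∫⁻ x in Ioc u v, ENNReal.ofReal (|deriv f x| / lam - s) := by
    have h1 : ENNReal.ofReal (2 * s * (v - u)) ≤
        ∫⁻ x in Ioc u v, ENNReal.ofReal (|deriv f x| / lam) := by
      have h2 := enorm_integral_le_lintegral_enorm (μ := volume.restrict (Ioc u v))
        (fun x => deriv f x / lam)
      rw [integral_div, ← intervalIntegral.integral_of_le huv.le, hf.integral_deriv_eq_sub] at h2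
      have e : ∀ y : ℝ, ‖y / lam‖ₑ = ENNReal.ofReal (|y| / lam) := by
        intro y
        rw [Real.enorm_eq_ofReal_abs, abs_div, abs_of_pos hlam]
      simp only [e] at h2
      rw [← hsf, mul_div_cancel_right₀ _ hlam.ne'] at h2
      exact h2
    have h3 : ∫⁻ x in Ioc u v, ENNReal.ofReal (|deriv f x| / lam) ≤
        (∫⁻ x in Ioc u v, ENNReal.ofReal (|deriv f x| / lam - s)) +
          ENNReal.ofReal (s * (v - u)) := by
      have : ENNReal.ofReal (s * (v - u)) = ∫⁻ x in Ioc u v, ENNReal.ofReal s := by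
        simp [ENNReal.ofReal_mul hs.le]
      rw [this, ← lintegral_add_right _ measurable_const]
      refine lintegral_mono fun x => ?_
      refine le_trans (le_of_eq ?_) ENNReal.ofReal_add_le
      congr 1; ring
    have h4 := h1.trans h3
    have h5 : 2 * s * (v - u) = s * (v - u) + s * (v - u) := by ring
    have h6 : 0 ≤ s * (v - u) := mul_nonneg hs.le (by linarith)
    rw [h5, ENNReal.ofReal_add h6 h6] at h4
    exact (ENNReal.add_le_add_iff_right ENNReal.ofReal_ne_top).1 h4
  have hmain : q * ENNReal.ofReal (s * (v - u)) ≤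
      ENNReal.ofReal (L * s) * ∫⁻ x in Ioc u v, φ x (|deriv f x| / lam) := by
    refine (mul_le_mul_right hint q).trans ((lintegral_const_mul_le _ _).trans ?_)
    rw [← lintegral_const_mul' _ _ ENNReal.ofReal_ne_top]
    exact setLIntegral_mono' measurableSet_Ioc hpt
  rw [ENNReal.ofReal_mul hs.le, mul_comm L s, ENNReal.ofReal_mul hs.le, mul_left_comm,
    mul_assoc] at hmain
  exact (ENNReal.mul_le_mul_iff_right (by simpa using hs) ENNReal.ofReal_ne_top).1 hmain

/-- one interval estimate -/
theorem aux_local {φ : ℝ → ℝ → ℝ≥0∞} {a b u v L β s lam : ℝ} (hab : a < b) (huv : u < v)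
    (hsub : Icc u v ⊆ Icc a b) (hL : 1 ≤ L) (h0 : ∀ x ∈ Icc a b, φ x 0 = 0)
    (h : ∀ x ∈ Icc a b, ∀ s t : ℝ, 0 < s → s ≤ t →
      φ x s / ENNReal.ofReal s ≤ ENNReal.ofReal L * (φ x t / ENNReal.ofReal t))
    (hβ : ∀ z r : ℝ, 0 < r → ∀ x ∈ Metric.ball z r ∩ Icc a b, ∀ y ∈ Metric.ball z r ∩ Icc a b,
      ∀ t : ℝ, 0 ≤ t → φ y t ≤ ENNReal.ofReal (2 * (L + 1) / (2 * r)) →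
        φ x (β * t) ≤ φ y t + 1)
    {f : ℝ → ℝ} (hf : AbsolutelyContinuousOnInterval f u v) (hlam : 0 < lam)
    (hs : 0 ≤ s) (hsf : 2 * s * (v - u) * lam = |f v - f u|)
    (hF : ∫⁻ x in Ioc u v, φ x (|deriv f x| / lam) ≤ 1) :
    phiSup φ (Icc u v) (β * s) * ENNReal.ofReal (v - u) ≤
      ENNReal.ofReal L * (∫⁻ x in Ioc u v, φ x (|deriv f x| / lam)) +
        ENNReal.ofReal (1 / (b - a) + 1) * ENNReal.ofReal (v - u) := by
  rcases hs.eq_or_lt with rfl | hs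
  · have : phiSup φ (Icc u v) (β * 0) = 0 := by
      simp only [phiSup, mul_zero]
      refine le_antisymm (iSup₂_le fun x hx => (h0 x (hsub hx)).le) (zero_le)
    rw [this]; simp
  have hJ := aux_jensen huv hL (fun x hx => h x (hsub hx)) hf hlam hs hsf
  set A := ∫⁻ x in Ioc u v, φ x (|deriv f x| / lam) with hA
  have hd : 0 < v - u := by linarith
  have hD : 0 < b - a := by linarith
  have hd0 : ENNReal.ofReal (v - u) ≠ 0 := by simpa using hd
  have hle : v - u ≤ b - a := by
    have h1 := hsub (left_mem_Icc.2 huv.le)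
    have h2 := hsub (right_mem_Icc.2 huv.le)
    linarith [h1.1, h2.2]
  have hq : phiInf φ (Icc u v) s ≤ ENNReal.ofReal L * A / ENNReal.ofReal (v - u) := by
    rwa [ENNReal.le_div_iff_mul_le (Or.inl hd0) (Or.inl ENNReal.ofReal_ne_top)]
  have hAt : A ≠ ⊤ := ne_top_of_le_ne_top ENNReal.one_ne_top hF
  have hfin : ENNReal.ofReal L * A / ENNReal.ofReal (v - u) ≠ ⊤ :=
    ENNReal.div_ne_top (ENNReal.mul_ne_top ENNReal.ofReal_ne_top hAt) hd0
  have hlt : phiInf φ (Icc u v) s <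
      ENNReal.ofReal L * A / ENNReal.ofReal (v - u) + ENNReal.ofReal (1 / (b - a)) :=
    hq.trans_lt (ENNReal.lt_add_right hfin (by simpa using hD))
  obtain ⟨y, hy, hyl⟩ : ∃ y ∈ Icc u v, φ y s <
      ENNReal.ofReal L * A / ENNReal.ofReal (v - u) + ENNReal.ofReal (1 / (b - a)) := by
    simpa only [phiInf, iInf_lt_iff, exists_prop] using hlt
  have hyK : φ y s ≤ ENNReal.ofReal (2 * (L + 1) / (2 * (v - u))) := by
    refine hyl.le.trans ?_
    have e : 2 * (L + 1) / (2 * (v - u)) = L / (v - u) + 1 / (v - u) := by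
      field_simp
    rw [e, ENNReal.ofReal_add (by positivity) (by positivity), ENNReal.ofReal_div_of_pos hd]
    gcongr
    calc ENNReal.ofReal L * A ≤ ENNReal.ofReal L * 1 := by gcongr
      _ = _ := mul_one _
  have hball : ∀ x ∈ Icc u v, x ∈ Metric.ball ((u + v) / 2) (v - u) ∩ Icc a b := by
    intro x hx
    refine ⟨?_, hsub hx⟩
    rw [Metric.mem_ball, Real.dist_eq, abs_lt]
    constructor <;> linarith [hx.1, hx.2]
  have hsup : phiSup φ (Icc u v) (β * s) ≤
      ENNReal.ofReal L * A / ENNReal.ofReal (v - u) + ENNReal.ofReal (1 / (b - a) + 1) := by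
    refine iSup₂_le fun x hx => ?_
    refine (hβ _ _ hd x (hball x hx) y (hball y hy) s hs.le hyK).trans ?_
    rw [ENNReal.ofReal_add (by positivity) zero_le_one, ENNReal.ofReal_one, ← add_assoc]
    gcongr
  calc _ ≤ (ENNReal.ofReal L * A / ENNReal.ofReal (v - u) + ENNReal.ofReal (1 / (b - a) + 1)) *
        ENNReal.ofReal (v - u) := by gcongr
    _ = _ := by rw [add_mul, ENNReal.div_mul_cancel hd0 ENNReal.ofReal_ne_top]

/-- global modular estimate -/
theorem aux_global {φ : ℝ → ℝ → ℝ≥0∞} {a b L β lam : ℝ} (hab : a < b)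
    (hL : 1 ≤ L) (h0 : ∀ x ∈ Icc a b, φ x 0 = 0)
    (h : ∀ x ∈ Icc a b, ∀ s t : ℝ, 0 < s → s ≤ t →
      φ x s / ENNReal.ofReal s ≤ ENNReal.ofReal L * (φ x t / ENNReal.ofReal t))
    (hβ0 : 0 < β)
    (hβ : ∀ z r : ℝ, 0 < r → ∀ x ∈ Metric.ball z r ∩ Icc a b, ∀ y ∈ Metric.ball z r ∩ Icc a b,
      ∀ t : ℝ, 0 ≤ t → φ y t ≤ ENNReal.ofReal (2 * (L + 1) / (2 * r)) →
        φ x (β * t) ≤ φ y t + 1)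
    {f : ℝ → ℝ} (hf : AbsolutelyContinuousOnInterval f a b) (hlam : 0 < lam)
    (hF : ∫⁻ x in Icc a b, φ x (|deriv f x| / lam) ≤ 1) :
    rieszVar φ a b (fun x => β / (2 * lam) * f x) ≤ ENNReal.ofReal (L + 1 + (b - a)) := by
  have hF' : ∫⁻ x in Ioc a b, φ x (|deriv f x| / lam) ≤ 1 :=
    (lintegral_mono_set Ioc_subset_Icc_self).trans hF
  have hD : 0 < b - a := by linarith
  refine iSup_le fun P => ?_
  have hterm : vSum φ (fun x => β / (2 * lam) * f x) P ≤ ∑ k ∈ Finset.range P.n,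
      (ENNReal.ofReal L * (∫⁻ x in Ioc (P.x k) (P.x (k + 1)), φ x (|deriv f x| / lam)) +
        ENNReal.ofReal (1 / (b - a) + 1) * ENNReal.ofReal (P.x (k + 1) - P.x k)) := by
    refine Finset.sum_le_sum fun k hk => ?_
    have hk := Finset.mem_range.1 hk
    have huv := P.strict k hk
    have hd : 0 < P.x (k + 1) - P.x k := by linarith
    have hsub := aux_part_Icc P hk
    have e : |β / (2 * lam) * f (P.x (k + 1)) - β / (2 * lam) * f (P.x k)| /
        (P.x (k + 1) - P.x k) =
        β * (|f (P.x (k + 1)) - f (P.x k)| / (2 * lam * (P.x (k + 1) - P.x k))) := by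
      rw [← mul_sub, abs_mul, abs_of_pos (by positivity : 0 < β / (2 * lam))]
      field_simp
    simp only [e]
    refine aux_local hab huv hsub hL h0 h hβ (hf.mono ?_) hlam (by positivity) ?_ ?_
    · rwa [uIcc_of_le huv.le, uIcc_of_le hab.le]
    · field_simp
    · refine (lintegral_mono_set ?_).trans hF
      exact Ioc_subset_Icc_self.trans hsub
  refine hterm.trans ?_
  rw [Finset.sum_add_distrib, ← Finset.mul_sum, ← Finset.mul_sum, aux_sum_lint P, aux_sum_len P,
    ← ENNReal.ofReal_mul (by positivity)]
  have e : L + 1 + (b - a) = L + (1 / (b - a) + 1) * (b - a) := by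
    field_simp
    ring
  rw [e, ENNReal.ofReal_add (by positivity) (by positivity)]
  gcongr
  calc _ ≤ ENNReal.ofReal L * 1 := by gcongr
    _ = _ := mul_one _

/-- Theorem 6.1.  Under (A0) and (A1), an absolutely continuous `f` with `f' ∈ L^φ(I)`
belongs to `RBV^φ(I)` and `‖f‖_{RBV^φ(I)} ≤ c ‖f'‖_{L^φ(I)}`, with `c` depending only on
`φ` and `|I|`. -/
theorem rbv_norm_le_lphi_norm_deriv (a b : ℝ) (hab : a < b)
    (φ : ℝ → ℝ → ℝ≥0∞) (hφ : IsPhiW φ (Set.Icc a b))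
    (hA0 : A0 φ (Set.Icc a b)) (hA1 : A1 φ (Set.Icc a b)) :
    ∃ c : ℝ, 0 < c ∧ ∀ f : ℝ → ℝ, AbsContOn f a b → MemLphi φ a b (deriv f) →
      MemRBV φ a b f ∧ rbvNorm φ a b f ≤ c * lphiNorm φ a b (deriv f) := by
  obtain ⟨L, hL, h⟩ := hφ.aInc1
  have h0 := hφ.map_zero
  obtain ⟨β, hβ0, hβ1, hβ⟩ := hA1 (2 * (L + 1)) (by linarith)
  have hD : 0 < b - a := by linarith
  set D := L + 1 + (b - a) with hDdef
  have hDpos : 1 ≤ D := by linarith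
  have hLD : 0 < L * D := by positivity
  refine ⟨2 * (L * D) / β, by positivity, ?_⟩
  intro f hf hmem
  have hac := aux_ac hab hf
  -- the modular estimate after scaling
  have key : ∀ lam : ℝ, 0 < lam → (∫⁻ x in Icc a b, φ x (|deriv f x| / lam)) ≤ 1 →
      rieszVar φ a b (fun x => f x / (2 * (L * D) / β * lam)) ≤ 1 := by
    intro lam hlam hint
    have h1 := aux_global hab hL h0 h hβ0 hβ hac hlam hint
    have h2 := aux_var_scale hL h0 h (fun x => β / (2 * lam) * f x)
      (θ := 1 / (L * D)) (by positivity) (by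
        rw [div_le_one hLD]; nlinarith)
    have e : (fun x => f x / (2 * (L * D) / β * lam)) =
        fun x => 1 / (L * D) * (β / (2 * lam) * f x) := by
      funext x
      field_simp
    rw [e]
    refine h2.trans ((mul_le_mul_right h1 _).trans ?_)
    rw [← ENNReal.ofReal_mul (by positivity)]
    have e2 : L * (1 / (L * D)) * D = 1 := by field_simp
    rw [← hDdef, e2, ENNReal.ofReal_one]
  -- nonemptiness of the Luxemburg set
  obtain ⟨lam0, hlam0, hint0⟩ : ∃ lam : ℝ, 0 < lam ∧
      (∫⁻ x in Icc a b, φ x (|deriv f x| / lam)) ≤ 1 := by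
    have h1 := hmem.2.eventually (eventually_le_nhds (zero_lt_one (α := ℝ≥0∞)))
    obtain ⟨μ, hμ, hμ0⟩ := (h1.and self_mem_nhdsWithin).exists
    have hμ0 : 0 < μ := hμ0
    refine ⟨μ⁻¹, by positivity, ?_⟩
    simpa only [div_inv_eq_mul, mul_comm] using hμ
  constructor
  · have hk := key lam0 hlam0 hint0
    set Λ := 2 * (L * D) / β * lam0 with hΛ
    have hΛ0 : 0 < Λ := by positivity
    have hb : ∀ᶠ lam : ℝ in nhdsWithin 0 (Ioi 0),
        rieszVar φ a b (fun x => lam * f x) ≤ ENNReal.ofReal (L * (Λ * lam)) := by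
      have h1 : ∀ᶠ lam : ℝ in nhdsWithin 0 (Ioi 0), lam < 1 / Λ :=
        mem_nhdsWithin_of_mem_nhds (Iio_mem_nhds (by positivity))
      filter_upwards [h1, self_mem_nhdsWithin] with lam hl hl0
      have hl0 : 0 < lam := hl0
      have h2 := aux_var_scale hL h0 h (fun x => f x / Λ) (θ := Λ * lam) (by positivity)
        (by rw [lt_div_iff₀ hΛ0] at hl; linarith)
      have e : (fun x => lam * f x) = fun x => Λ * lam * (f x / Λ) := by
        funext x
        field_simp
      rw [e]
      refine h2.trans ((mul_le_mul_right hk _).trans ?_)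
      rw [mul_one]
    refine tendsto_of_tendsto_of_tendsto_of_le_of_le' tendsto_const_nhds ?_
      (Eventually.of_forall fun _ => zero_le) hb
    have hc : Continuous fun lam : ℝ => ENNReal.ofReal (L * (Λ * lam)) :=
      ENNReal.continuous_ofReal.comp (by fun_prop)
    have := hc.tendsto 0
    simp only [mul_zero, ENNReal.ofReal_zero] at this
    exact this.mono_left nhdsWithin_le_nhds
  · have hc0 : 0 < 2 * (L * D) / β := by positivity
    rw [← div_le_iff₀' hc0]
    refine le_csInf ⟨lam0, hlam0, hint0⟩ ?_
    rintro lam ⟨hlam, hint⟩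
    rw [div_le_iff₀' hc0]
    exact csInf_le ⟨0, fun y hy => hy.1.le⟩ ⟨by positivity, key lam hlam hint⟩
end
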